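/- arXiv:1107.5730 — 2 statements merged into one kernel-verified Lean document; each statement's English description precedes it below -/
import Mathlib

section
/- (Optimal diversity gives exponential decay.) Fix κ ∈ (0,1/2) and SNR > 0, and let ρ(α, J) denote the infimum over total sampling rates ρ such that distortion α is achievable with diversity J by the optimal (unrestricted) estimator in the joint sparsity model. Then there exist constants 0 < c ≤ C < ∞ and a choice of diversity J*(α) with c·log(1/α) ≤ J*(α) ≤ C·log(1/α) such that c·log(1/α) ≤ ρ(α, J*(α)) ≤ C·log(1/α) for all sufficiently small α > 0; i.e., with J = Θ(log(1/α)) the minimal total sampling rate satisfies ρ(α, J*(α)) = Θ(log(1/α)), so the distortion can decay exponentially in the sampling rate. -/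
open MeasureTheory ProbabilityTheory Real Filter Finset Topology
open scoped ENNReal NNReal

noncomputable section

namespace Sparsity

/-- Binary entropy function (natural logarithms). -/
def Hb (p : ℝ) : ℝ := -(p * Real.log p) - (1 - p) * Real.log (1 - p)

/-- The metric entropy rate `R(κ, α)`. -/
def Rrate (κ α : ℝ) : ℝ :=
  if α < 1 - κ then Hb κ - κ * Hb α - (1 - κ) * Hb (κ * α / (1 - κ)) else 0

/-- The standard gaussian measure on `ℝ`. -/
def stdGaussian : Measure ℝ := gaussianReal 0 1

instance : IsProbabilityMeasure stdGaussian := by unfold stdGaussian; infer_instance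

/-- i.i.d. standard gaussian measure on `ι → ℝ`. -/
def gaussianPi (ι : Type*) [Fintype ι] : Measure (ι → ℝ) := Measure.pi fun _ => stdGaussian

instance (ι : Type*) [Fintype ι] : IsProbabilityMeasure (gaussianPi ι) := by
  unfold gaussianPi; infer_instance

/-- CDF of a normalized chi-square with `J` degrees of freedom,
i.e. the law of `(1/J) ∑_{j<J} U_j^2` with `U_j` i.i.d. standard gaussian. -/
def chiCDF (J : ℕ) (t : ℝ) : ℝ :=
  ((gaussianPi (Fin J)) {u | ∑ j, (u j) ^ 2 ≤ J * t}).toReal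

/-- Quantile function `ξ_J` of the normalized chi-square with `J` degrees of freedom. -/
def xi (J : ℕ) (p : ℝ) : ℝ := sInf {t : ℝ | 0 ≤ t ∧ p ≤ chiCDF J t}

/-- The diversity power `P_J(β) = ∫_0^β ξ_J(p) dp`. -/
def Ppow (J : ℕ) (β : ℝ) : ℝ := ∫ p in (0:ℝ)..β, xi J p

/-- All sparsity patterns: size-`k` subsets of `{1,…,n}`. -/
def patterns (n k : ℕ) : Finset (Finset (Fin n)) := Finset.powersetCard k Finset.univ

/-- The underlying randomness for the joint sparsity model: nonzero values `ω.1`,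
measurement matrices `ω.2.1`, and additive noise `ω.2.2`. -/
abbrev Omega (n m J : ℕ) : Type :=
  (Fin J → Fin n → ℝ) × (Fin J → Fin m → Fin n → ℝ) × (Fin J → Fin m → ℝ)

/-- The law of the randomness: everything i.i.d. standard gaussian. -/
def omegaLaw (n m J : ℕ) : Measure (Omega n m J) :=
  (Measure.pi fun _ : Fin J => gaussianPi (Fin n)).prod
    ((Measure.pi fun _ : Fin J => Measure.pi fun _ : Fin m => gaussianPi (Fin n)).prod
      (Measure.pi fun _ : Fin J => gaussianPi (Fin m)))

/-- The sparse signal with pattern `S` and nonzero values `x`. -/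
def signal (n : ℕ) (S : Finset (Fin n)) (x : Fin n → ℝ) : Fin n → ℝ :=
  fun i => if i ∈ S then x i else 0

/-- The noisy observations `Y_j = √(SNR/k)·A_j X_j + W_j`. -/
def Yobs (n m J : ℕ) (SNR : ℝ) (k : ℕ) (S : Finset (Fin n)) (ω : Omega n m J) :
    Fin J → Fin m → ℝ :=
  fun j r =>
    Real.sqrt (SNR / k) * (∑ i, ω.2.1 j r i * signal n S (ω.1 j) i) + ω.2.2 j r

/-- Normalized distortion `d(S,T) = max(|S∖T|, |T∖S|)/k`. -/
def distor (k : ℕ) {n : ℕ} (S T : Finset (Fin n)) : ℝ :=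
  (max (S \ T).card (T \ S).card : ℝ) / k

/-- A sparsity pattern estimator: a function of the observations `(Y_j)_j`
and of the measurement matrices `(A_j)_j`. -/
abbrev Estimator (n m J : ℕ) : Type :=
  (Fin J → Fin m → ℝ) → (Fin J → Fin m → Fin n → ℝ) → Finset (Fin n)

/-- The probability that the estimator `est` makes distortion larger than `α`,
averaged over the uniformly distributed sparsity pattern. -/
def errProb (n m J k : ℕ) (SNR α : ℝ) (est : Estimator n m J) : ℝ :=
  (n.choose k : ℝ)⁻¹ * ∑ S ∈ patterns n k,
    (omegaLaw n m J
      {ω | α < distor k S (est (Yobs n m J SNR k S ω) ω.2.1)}).toReal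

/-- Distortion `α` is achievable (by some estimator sequence) at sparsity rate `κ`,
signal-to-noise ratio `SNR`, total sampling rate `ρ` and diversity `J`. -/
def achievable (κ SNR ρ : ℝ) (J : ℕ) (α : ℝ) : Prop :=
  ∃ (k m : ℕ → ℕ) (est : ∀ n, Estimator n (m n) J),
    Tendsto (fun n => (k n : ℝ) / n) atTop (𝓝 κ) ∧
    Tendsto (fun n => (J : ℝ) * (m n) / n) atTop (𝓝 ρ) ∧
    Tendsto (fun n => errProb n (m n) J (k n) SNR α (est n)) atTop (𝓝 0)

/-- The infimum total sampling rate at which distortion `α` is achievable. -/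
def rhoStar (κ SNR : ℝ) (J : ℕ) (α : ℝ) : ℝ := sInf {ρ | achievable κ SNR ρ J α}

end Sparsity

namespace Sparsity

theorem lintegral_pi_prod {ι : Type*} [Fintype ι] {E : ι → Type*} [∀ i, MeasurableSpace (E i)]
    (μ : ∀ i, Measure (E i)) [∀ i, IsProbabilityMeasure (μ i)] {f : ∀ i, E i → ℝ≥0∞}
    (hf : ∀ i, Measurable (f i)) :
    ∫⁻ x, ∏ i, f i (x i) ∂Measure.pi μ = ∏ i, ∫⁻ y, f i y ∂μ i := by
  rw [lintegral_prod_eq_prod_lintegral_of_indepFun univ (fun i (x : ∀ i, E i) => f i (x i))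
    (iIndepFun_pi fun i => (hf i).aemeasurable) fun i => (hf i).comp (measurable_pi_apply i)]
  exact prod_congr rfl fun i _ => (measurePreserving_eval μ i).lintegral_comp (hf i)

theorem pi_withDensity {ι : Type*} [Fintype ι] {E : ι → Type*} [∀ i, MeasurableSpace (E i)]
    (μ : ∀ i, Measure (E i)) [∀ i, IsProbabilityMeasure (μ i)] {f : ∀ i, E i → ℝ≥0∞}
    (hf : ∀ i, Measurable (f i)) [∀ i, SigmaFinite ((μ i).withDensity (f i))] :
    Measure.pi (fun i => (μ i).withDensity (f i)) =
      (Measure.pi μ).withDensity fun x => ∏ i, f i (x i) := by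
  refine Measure.pi_eq fun s hs => ?_
  rw [withDensity_apply _ (MeasurableSet.univ_pi hs), ← lintegral_indicator (.univ_pi hs)]
  have h : ∀ x : ∀ i, E i, (Set.univ.pi s).indicator (fun x => ∏ i, f i (x i)) x
      = ∏ i, (s i).indicator (f i) (x i) := by
    intro x
    by_cases hx : x ∈ Set.univ.pi s
    · rw [Set.indicator_of_mem hx]
      exact prod_congr rfl fun i _ => (Set.indicator_of_mem (hx i trivial) _).symm
    · rw [Set.indicator_of_notMem hx]
      simp only [Set.mem_pi, Set.mem_univ, true_imp_iff, not_forall] at hx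
      obtain ⟨i, hi⟩ := hx
      exact (prod_eq_zero (mem_univ i) (Set.indicator_of_notMem hi _)).symm
  simp_rw [h]
  rw [lintegral_pi_prod μ fun i => (hf i).indicator (hs i)]
  exact prod_congr rfl fun i _ => by
    rw [lintegral_indicator (hs i), withDensity_apply _ (hs i)]

theorem pi_map_add_eq_withDensity {ι : Type*} [Fintype ι] {E : ι → Type*}
    [∀ i, MeasurableSpace (E i)] [∀ i, Add (E i)] [∀ i, MeasurableAdd (E i)]
    (μ : ∀ i, Measure (E i)) [∀ i, IsProbabilityMeasure (μ i)] {f : ∀ i, E i → ℝ≥0∞}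
    (hf : ∀ i, Measurable (f i)) (u : ∀ i, E i)
    (h : ∀ i, (μ i).map (fun x => u i + x) = (μ i).withDensity (f i)) :
    (Measure.pi μ).map (fun x i => u i + x i) =
      (Measure.pi μ).withDensity fun x => ∏ i, f i (x i) := by
  have hm : ∀ i, IsProbabilityMeasure ((μ i).map fun x => u i + x) := fun i =>
    Measure.isProbabilityMeasure_map (measurable_const_add _).aemeasurable
  have hp : ∀ i, IsProbabilityMeasure ((μ i).withDensity (f i)) := fun i => h i ▸ hm i
  rw [← pi_withDensity μ hf, Measure.pi_map_pi (f := fun i x => u i + x)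
    fun i => (measurable_const_add _).aemeasurable]
  simp_rw [h]

theorem stdGaussian_map_add (u : ℝ) :
    stdGaussian.map (fun x => u + x) =
      stdGaussian.withDensity fun x => ENNReal.ofReal (exp (u * x - u ^ 2 / 2)) := by
  rw [stdGaussian, gaussianReal_map_const_add, gaussianReal_of_var_ne_zero _ one_ne_zero,
    gaussianReal_of_var_ne_zero _ one_ne_zero,
    ← withDensity_mul _ (measurable_gaussianPDF _ _) (by fun_prop)]
  congr 1
  ext x
  rw [Pi.mul_apply, gaussianPDF, gaussianPDF, ← ENNReal.ofReal_mul (gaussianPDFReal_nonneg _ _ _)]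
  congr 1
  rw [gaussianPDFReal, gaussianPDFReal, mul_assoc _ (rexp _), ← exp_add]
  congr 2
  simp
  ring

/-- The law of the noise matrix. -/
def noiseLaw (J m : ℕ) : Measure (Fin J → Fin m → ℝ) := Measure.pi fun _ => gaussianPi (Fin m)

instance (J m : ℕ) : IsProbabilityMeasure (noiseLaw J m) := by unfold noiseLaw; infer_instance

/-- Density of the noise shifted by `u` with respect to the centered noise. -/
def shiftDensity {J m : ℕ} (u y : Fin J → Fin m → ℝ) : ℝ≥0∞ :=
  ENNReal.ofReal (exp (∑ j, ∑ r, (u j r * y j r - u j r ^ 2 / 2)))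

theorem noiseLaw_map_add {J m : ℕ} (u : Fin J → Fin m → ℝ) :
    (noiseLaw J m).map (fun w j r => u j r + w j r) = (noiseLaw J m).withDensity (shiftDensity u) := by
  have h1 : ∀ j, (gaussianPi (Fin m)).map (fun w => u j + w) =
      (gaussianPi (Fin m)).withDensity
        fun w => ∏ r, ENNReal.ofReal (exp (u j r * w r - u j r ^ 2 / 2)) := fun j =>
    pi_map_add_eq_withDensity (E := fun _ => ℝ) (fun _ : Fin m => stdGaussian)
      (f := fun r x => ENNReal.ofReal (exp (u j r * x - u j r ^ 2 / 2)))
      (fun r => by fun_prop) (u j) fun r => stdGaussian_map_add _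
  have h2 := pi_map_add_eq_withDensity (E := fun _ => Fin m → ℝ)
    (fun _ : Fin J => gaussianPi (Fin m)) (fun j => by fun_prop) u h1
  refine h2.trans ?_
  rw [noiseLaw]
  congr 1
  ext y
  simp_rw [shiftDensity, exp_sum]
  rw [ENNReal.ofReal_prod_of_nonneg fun _ _ => by positivity]
  exact prod_congr rfl fun j _ => (ENNReal.ofReal_prod_of_nonneg fun _ _ => by positivity).symm

theorem measurable_shiftDensity {J m : ℕ} (u : Fin J → Fin m → ℝ) :
    Measurable (shiftDensity u) := by
  unfold shiftDensity; fun_prop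

theorem lintegral_noiseLaw_add {J m : ℕ} (u : Fin J → Fin m → ℝ)
    {F : (Fin J → Fin m → ℝ) → ℝ≥0∞} (hF : Measurable F) :
    ∫⁻ w, F (fun j r => u j r + w j r) ∂noiseLaw J m =
      ∫⁻ y, shiftDensity u y * F y ∂noiseLaw J m := by
  have hg : Measurable fun (w : Fin J → Fin m → ℝ) j r => u j r + w j r := by fun_prop
  rw [← lintegral_map hF hg, noiseLaw_map_add,
    lintegral_withDensity_eq_lintegral_mul _ (measurable_shiftDensity u) hF]
  rfl

theorem lintegral_shiftDensity {J m : ℕ} (u : Fin J → Fin m → ℝ) :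
    ∫⁻ y, shiftDensity u y ∂noiseLaw J m = 1 := by
  have h := lintegral_noiseLaw_add u (F := fun _ => 1) measurable_const
  simpa using h.symm

/-- The law of the nonzero values. -/
def signalLaw (J n : ℕ) : Measure (Fin J → Fin n → ℝ) := Measure.pi fun _ => gaussianPi (Fin n)

instance (J n : ℕ) : IsProbabilityMeasure (signalLaw J n) := by unfold signalLaw; infer_instance

/-- The law of the measurement matrices. -/
def matrixLaw (J m n : ℕ) : Measure (Fin J → Fin m → Fin n → ℝ) :=
  Measure.pi fun _ => Measure.pi fun _ => gaussianPi (Fin n)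

instance (J m n : ℕ) : IsProbabilityMeasure (matrixLaw J m n) := by
  unfold matrixLaw; infer_instance

theorem omegaLaw_eq (n m J : ℕ) :
    omegaLaw n m J = (signalLaw J n).prod ((matrixLaw J m n).prod (noiseLaw J m)) := rfl

instance (n m J : ℕ) : IsProbabilityMeasure (omegaLaw n m J) := by
  rw [omegaLaw_eq]; infer_instance

/-- The noiseless observations, with signal amplitude `s`. -/
def meanObs {n m J : ℕ} (s : ℝ) (S : Finset (Fin n)) (x : Fin J → Fin n → ℝ)
    (a : Fin J → Fin m → Fin n → ℝ) : Fin J → Fin m → ℝ :=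
  fun j r => s * ∑ i, a j r i * ((if i ∈ S then 1 else 0) * x j i)

theorem Yobs_eq {n m J : ℕ} (SNR : ℝ) (k : ℕ) (S : Finset (Fin n)) (ω : Omega n m J) :
    Yobs n m J SNR k S ω = fun j r => meanObs √(SNR / k) S ω.1 ω.2.1 j r + ω.2.2 j r := by
  ext j r
  simp [Yobs, meanObs, signal]

/-- Density of the observations given the matrices, with respect to the noise law. -/
def obsDensity {n m J : ℕ} (s : ℝ) (S : Finset (Fin n))
    (z : (Fin J → Fin m → Fin n → ℝ) × (Fin J → Fin m → ℝ)) : ℝ≥0∞ :=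
  ∫⁻ x, shiftDensity (meanObs s S x z.1) z.2 ∂signalLaw J n

@[fun_prop]
theorem measurable_shiftDensity_meanObs {n m J : ℕ} (s : ℝ) (S : Finset (Fin n)) {Ω : Type*}
    [MeasurableSpace Ω] {x : Ω → Fin J → Fin n → ℝ} {a : Ω → Fin J → Fin m → Fin n → ℝ}
    {y : Ω → Fin J → Fin m → ℝ} (hx : Measurable x) (ha : Measurable a) (hy : Measurable y) :
    Measurable fun p => shiftDensity (meanObs s S (x p) (a p)) (y p) := by
  unfold shiftDensity meanObs; fun_prop

theorem measurable_obsDensity {n m J : ℕ} (s : ℝ) (S : Finset (Fin n)) :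
    Measurable (obsDensity (m := m) (J := J) s S) := by
  unfold obsDensity
  refine Measurable.lintegral_prod_right ?_
  unfold Function.uncurry
  fun_prop

theorem lintegral_obsDensity {n m J : ℕ} (s : ℝ) (S : Finset (Fin n)) :
    ∫⁻ z, obsDensity s S z ∂(matrixLaw J m n).prod (noiseLaw J m) = 1 := by
  unfold obsDensity
  have hm : Measurable (Function.uncurry fun
      (z : (Fin J → Fin m → Fin n → ℝ) × (Fin J → Fin m → ℝ)) (x : Fin J → Fin n → ℝ) =>
      shiftDensity (meanObs s S x z.1) z.2) := by
    unfold Function.uncurry; fun_prop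
  rw [lintegral_lintegral_swap hm.aemeasurable]
  have h : ∀ x, ∫⁻ z, shiftDensity (meanObs s S x z.1) z.2 ∂(matrixLaw J m n).prod (noiseLaw J m)
      = 1 := by
    intro x
    have hx : Measurable fun z : (Fin J → Fin m → Fin n → ℝ) × (Fin J → Fin m → ℝ) =>
        shiftDensity (meanObs s S x z.1) z.2 := by fun_prop
    rw [lintegral_prod _ hx.aemeasurable]
    simp only [lintegral_shiftDensity, lintegral_one, measure_univ]
  simp only [h, lintegral_one, measure_univ]

theorem exists_measurable_ge_indicator_obsDensity {n m J k : ℕ} (SNR : ℝ) (S : Finset (Fin n))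
    (D : Set ((Fin J → Fin m → Fin n → ℝ) × (Fin J → Fin m → ℝ))) :
    ∃ h : (Fin J → Fin m → Fin n → ℝ) × (Fin J → Fin m → ℝ) → ℝ≥0∞, Measurable h ∧
      D.indicator (obsDensity √(SNR / k) S) ≤ h ∧
      ∫⁻ z, h z ∂(matrixLaw J m n).prod (noiseLaw J m) =
        omegaLaw n m J {ω | (ω.2.1, Yobs n m J SNR k S ω) ∈ D} := by
  set s := √(SNR / k)
  set E := {ω : Omega n m J | (ω.2.1, Yobs n m J SNR k S ω) ∈ D}
  set B := toMeasurable (omegaLaw n m J) E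
  have hB : MeasurableSet B := measurableSet_toMeasurable _ _
  have h1 : Measurable (B.indicator (1 : Omega n m J → ℝ≥0∞)) := measurable_one.indicator hB
  set G : (Fin J → Fin n → ℝ) → (Fin J → Fin m → Fin n → ℝ) × (Fin J → Fin m → ℝ) → ℝ≥0∞ :=
    fun x z => shiftDensity (meanObs s S x z.1) z.2 *
      B.indicator 1 (x, z.1, fun j r => z.2 j r - meanObs s S x z.1 j r) with hG
  have hGm : Measurable (Function.uncurry G) := by
    refine (measurable_shiftDensity_meanObs s S (by fun_prop) (by fun_prop) (by fun_prop)).mul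
      (h1.comp ?_)
    unfold meanObs; fun_prop
  have h2 : omegaLaw n m J E = ∫⁻ x, ∫⁻ z, G x z ∂(matrixLaw J m n).prod (noiseLaw J m)
      ∂signalLaw J n := by
    rw [← measure_toMeasurable E, ← lintegral_indicator_one hB, omegaLaw_eq,
      lintegral_prod _ h1.aemeasurable]
    refine lintegral_congr fun x => ?_
    rw [lintegral_prod (fun z => B.indicator 1 (x, z))
        (h1.comp measurable_prodMk_left).aemeasurable,
      lintegral_prod (G x) (hGm.comp measurable_prodMk_left).aemeasurable]
    refine lintegral_congr fun a => ?_
    have h3 := lintegral_noiseLaw_add (meanObs s S x a)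
      (F := fun y => B.indicator 1 (x, a, fun j r => y j r - meanObs s S x a j r))
      (h1.comp (by fun_prop))
    simpa only [add_sub_cancel_left] using h3
  refine ⟨fun z => ∫⁻ x, G x z ∂signalLaw J n, hGm.lintegral_prod_left, fun z => ?_,
    by rw [h2, lintegral_lintegral_swap hGm.aemeasurable]⟩
  by_cases hz : z ∉ D
  · simp [hz]
  rw [not_not] at hz
  rw [Set.indicator_of_mem hz]
  refine lintegral_mono fun x => ?_
  have h4 : (x, z.1, fun j r => z.2 j r - meanObs s S x z.1 j r) ∈ B := by
    refine subset_toMeasurable _ _ ?_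
    simp only [E, Set.mem_ofPred_eq, Yobs_eq]
    convert! hz using 1
    ext j r <;> simp [s]
  simp [hG, h4]

/-- Negating the `i`-th coordinate of every signal. -/
def flip {J n : ℕ} (i : Fin n) (x : Fin J → Fin n → ℝ) : Fin J → Fin n → ℝ :=
  fun j l => (if l = i then -1 else 1) * x j l

theorem measurePreserving_flip {J n : ℕ} (i : Fin n) :
    MeasurePreserving (flip i) (signalLaw J n) (signalLaw J n) := by
  refine measurePreserving_pi (fun _ => gaussianPi (Fin n)) _
    (f := fun _ y l => (if l = i then -1 else 1) * y l) fun j => ?_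
  refine measurePreserving_pi (fun _ => stdGaussian) _
    (f := fun l y => (if l = i then -1 else 1) * y) fun l => ⟨by fun_prop, ?_⟩
  split_ifs
  · simpa [stdGaussian] using gaussianReal_map_neg (μ := 0) (v := 1)
  · simp

/-- The energy of the contribution of entry `i` to the observations. -/
def entryEnergy {n m J : ℕ} (s : ℝ) (i : Fin n) (x : Fin J → Fin n → ℝ)
    (a : Fin J → Fin m → Fin n → ℝ) : ℝ :=
  ∑ j, ∑ r, (s * (a j r i * x j i)) ^ 2

theorem meanObs_erase {n m J : ℕ} (s : ℝ) {S : Finset (Fin n)} {i : Fin n} (hi : i ∈ S)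
    (x : Fin J → Fin n → ℝ) (a : Fin J → Fin m → Fin n → ℝ) (j : Fin J) (r : Fin m) :
    meanObs s S x a j r = meanObs s (S.erase i) x a j r + s * (a j r i * x j i) := by
  have h : ∀ l, a j r l * ((if l ∈ S then 1 else 0) * x j l) =
      a j r l * ((if l ∈ S.erase i then 1 else 0) * x j l) +
        if l = i then a j r i * x j i else 0 := by
    intro l
    by_cases h : l = i
    · subst h; simp [hi]
    · simp [h]
  simp_rw [meanObs, h, sum_add_distrib]
  simp [mul_add]

theorem meanObs_flip {n m J : ℕ} (s : ℝ) {S : Finset (Fin n)} {i : Fin n} (hi : i ∉ S)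
    (x : Fin J → Fin n → ℝ) (a : Fin J → Fin m → Fin n → ℝ) :
    meanObs s S (flip i x) a = meanObs s S x a := by
  ext j r
  unfold meanObs
  congr 1
  refine sum_congr rfl fun l _ => ?_
  by_cases h : l = i
  · subst h; simp [hi]
  · simp [flip, h]

theorem two_mul_exp_le (P t : ℝ) : 2 * exp P ≤ exp (P + t) + exp (P - t) := by
  rw [exp_add, sub_eq_add_neg, exp_add, ← mul_add, mul_comm]
  gcongr
  linarith [add_one_le_exp t, add_one_le_exp (-t)]

theorem two_mul_shiftDensity_le {n m J : ℕ} (s : ℝ) {S : Finset (Fin n)} {i : Fin n} (hi : i ∈ S)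
    (x : Fin J → Fin n → ℝ) (a : Fin J → Fin m → Fin n → ℝ) (y : Fin J → Fin m → ℝ) :
    2 * (shiftDensity (meanObs s (S.erase i) x a) y *
        ENNReal.ofReal (exp (-(entryEnergy s i x a / 2)))) ≤
      shiftDensity (meanObs s S x a) y + shiftDensity (meanObs s S (flip i x) a) y := by
  set u := meanObs s (S.erase i) x a
  set b : Fin J → Fin m → ℝ := fun j r => s * (a j r i * x j i) with hb
  have h1 : ∀ j r, meanObs s S x a j r = u j r + b j r := fun j r => meanObs_erase s hi x a j r
  have h2 : ∀ j r, meanObs s S (flip i x) a j r = u j r - b j r := fun j r => by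
    rw [meanObs_erase s hi, meanObs_flip s (notMem_erase i S)]
    simp [flip, u, b]; ring
  set P := ∑ j, ∑ r, (u j r * y j r - u j r ^ 2 / 2) - entryEnergy s i x a / 2 with hP
  set t := ∑ j, ∑ r, b j r * (y j r - u j r) with ht
  have hP' : P = ∑ j, ∑ r, (u j r * y j r - u j r ^ 2 / 2 - b j r ^ 2 / 2) := by
    rw [hP, entryEnergy]
    simp only [sum_sub_distrib, sum_div]
    rfl
  have h3 : ∑ j, ∑ r, (meanObs s S x a j r * y j r - meanObs s S x a j r ^ 2 / 2) = P + t := by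
    rw [hP', ht]
    simp only [← sum_add_distrib, h1]
    exact sum_congr rfl fun j _ => sum_congr rfl fun r _ => by ring
  have h4 : ∑ j, ∑ r, (meanObs s S (flip i x) a j r * y j r - meanObs s S (flip i x) a j r ^ 2 / 2)
      = P - t := by
    rw [hP', ht]
    simp only [← sum_sub_distrib, h2]
    exact sum_congr rfl fun j _ => sum_congr rfl fun r _ => by ring
  rw [shiftDensity, shiftDensity, shiftDensity, h3, h4, ← ENNReal.ofReal_mul (exp_pos _).le,
    ← exp_add, ← sub_eq_add_neg, ← hP, ← ENNReal.ofReal_add (exp_pos _).le (exp_pos _).le,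
    ← ENNReal.ofReal_ofNat 2, ← ENNReal.ofReal_mul zero_le_two]
  exact ENNReal.ofReal_le_ofReal (two_mul_exp_le P t)

theorem entryEnergy_nonneg {n m J : ℕ} (s : ℝ) (i : Fin n) (x : Fin J → Fin n → ℝ)
    (a : Fin J → Fin m → Fin n → ℝ) : 0 ≤ entryEnergy s i x a :=
  sum_nonneg fun _ _ => sum_nonneg fun _ _ => sq_nonneg _

theorem le_obsDensity {n m J : ℕ} (s : ℝ) {S : Finset (Fin n)} {i : Fin n} (hi : i ∈ S)
    {Q : (Fin J → Fin n → ℝ) → ℝ} (z : (Fin J → Fin m → Fin n → ℝ) × (Fin J → Fin m → ℝ))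
    (hQ : ∀ x, entryEnergy s i x z.1 ≤ Q x) :
    ∫⁻ x, shiftDensity (meanObs s (S.erase i) x z.1) z.2 * ENNReal.ofReal (exp (-(Q x / 2)))
      ∂signalLaw J n ≤ obsDensity s S z := by
  have hm : Measurable fun x => shiftDensity (meanObs s S x z.1) z.2 := by
    fun_prop
  have hf : ∫⁻ x, shiftDensity (meanObs s S (flip i x) z.1) z.2 ∂signalLaw J n =
      obsDensity s S z := (measurePreserving_flip i).lintegral_comp hm
  have h : 2 * ∫⁻ x, shiftDensity (meanObs s (S.erase i) x z.1) z.2 *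
      ENNReal.ofReal (exp (-(Q x / 2))) ∂signalLaw J n ≤ 2 * obsDensity s S z := by
    calc _ = ∫⁻ x, 2 * (shiftDensity (meanObs s (S.erase i) x z.1) z.2 *
          ENNReal.ofReal (exp (-(Q x / 2)))) ∂signalLaw J n :=
        (lintegral_const_mul' _ _ (by simp)).symm
      _ ≤ ∫⁻ x, (shiftDensity (meanObs s S x z.1) z.2 +
          shiftDensity (meanObs s S (flip i x) z.1) z.2) ∂signalLaw J n := by
        refine lintegral_mono fun x => le_trans ?_ (two_mul_shiftDensity_le s hi x z.1 z.2)
        gcongr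
        exact hQ x
      _ = obsDensity s S z + obsDensity s S z := by rw [lintegral_add_left hm, hf, obsDensity]
      _ = _ := (two_mul _).symm
  exact (ENNReal.mul_le_mul_iff_right (by simp) (by simp)).1 h

theorem lintegral_sq_stdGaussian : ∫⁻ x, ENNReal.ofReal (x ^ 2) ∂stdGaussian = 1 := by
  have h1 : Integrable (fun x : ℝ => x ^ 2) stdGaussian := by
    have := memLp_id_gaussianReal (μ := 0) (v := 1) 2
    simpa [stdGaussian] using this.integrable_sq
  rw [← ofReal_integral_eq_lintegral_ofReal h1 (ae_of_all _ fun x => sq_nonneg x)]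
  have h2 := variance_fun_id_gaussianReal (μ := 0) (v := 1)
  rw [variance_eq_integral (by fun_prop)] at h2
  simp only [integral_id_gaussianReal, sub_zero, NNReal.coe_one] at h2
  rw [stdGaussian, h2, ENNReal.ofReal_one]

theorem lintegral_signalLaw_eval {J n : ℕ} (j : Fin J) (i : Fin n) {f : ℝ → ℝ≥0∞}
    (hf : Measurable f) : ∫⁻ x, f (x j i) ∂signalLaw J n = ∫⁻ y, f y ∂stdGaussian := by
  have h1 := (measurePreserving_eval (fun _ : Fin J => gaussianPi (Fin n)) j).lintegral_comp
    (f := fun y => f (y i)) (by fun_prop)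
  have h2 := (measurePreserving_eval (fun _ : Fin n => stdGaussian) i).lintegral_comp hf
  exact h1.trans h2

theorem lintegral_matrixLaw_eval {J m n : ℕ} (j : Fin J) (r : Fin m) (i : Fin n) {f : ℝ → ℝ≥0∞}
    (hf : Measurable f) : ∫⁻ a, f (a j r i) ∂matrixLaw J m n = ∫⁻ y, f y ∂stdGaussian := by
  have h1 := (measurePreserving_eval
    (fun _ : Fin J => Measure.pi fun _ : Fin m => gaussianPi (Fin n)) j).lintegral_comp
    (f := fun y => f (y r i)) (by fun_prop)
  exact h1.trans (lintegral_signalLaw_eval r i hf)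

theorem lintegral_entryEnergy {J m n : ℕ} (s : ℝ) (i : Fin n) :
    ∫⁻ x, ∫⁻ a, ENNReal.ofReal (entryEnergy s i x a) ∂matrixLaw J m n ∂signalLaw J n =
      ENNReal.ofReal (J * m * s ^ 2) := by
  have h1 : ∀ (x : Fin J → Fin n → ℝ) (a : Fin J → Fin m → Fin n → ℝ),
      ENNReal.ofReal (entryEnergy s i x a) = ∑ j, ∑ r,
        ENNReal.ofReal (s ^ 2) * ENNReal.ofReal (x j i ^ 2) * ENNReal.ofReal (a j r i ^ 2) := by
    intro x a
    rw [entryEnergy, ENNReal.ofReal_sum_of_nonneg fun _ _ => sum_nonneg fun _ _ => sq_nonneg _]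
    refine sum_congr rfl fun j _ => ?_
    rw [ENNReal.ofReal_sum_of_nonneg fun _ _ => sq_nonneg _]
    refine sum_congr rfl fun r _ => ?_
    rw [← ENNReal.ofReal_mul (sq_nonneg _), ← ENNReal.ofReal_mul (by positivity)]
    ring_nf
  have h2 : ∀ x : Fin J → Fin n → ℝ,
      ∫⁻ a, ENNReal.ofReal (entryEnergy s i x a) ∂matrixLaw J m n =
        ∑ j, ∑ r : Fin m, ENNReal.ofReal (s ^ 2) * ENNReal.ofReal (x j i ^ 2) := by
    intro x
    simp_rw [h1]
    rw [lintegral_finsetSum _ fun j _ => by fun_prop]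
    refine sum_congr rfl fun j _ => ?_
    rw [lintegral_finsetSum _ fun j _ => by fun_prop]
    refine sum_congr rfl fun r _ => ?_
    rw [lintegral_const_mul _ (by fun_prop),
      lintegral_matrixLaw_eval j r i (f := fun y => ENNReal.ofReal (y ^ 2)) (by fun_prop),
      lintegral_sq_stdGaussian, mul_one]
  simp_rw [h2]
  rw [lintegral_finsetSum _ fun j _ => by fun_prop]
  have h3 : ∀ j : Fin J, ∫⁻ x, ∑ r : Fin m, ENNReal.ofReal (s ^ 2) * ENNReal.ofReal (x j i ^ 2)
      ∂signalLaw J n = m * ENNReal.ofReal (s ^ 2) := by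
    intro j
    rw [lintegral_finsetSum _ fun r _ => by fun_prop, lintegral_const_mul _ (by fun_prop),
      lintegral_signalLaw_eval j i (f := fun y => ENNReal.ofReal (y ^ 2)) (by fun_prop),
      lintegral_sq_stdGaussian, mul_one]
    simp
  simp_rw [h3]
  rw [ENNReal.ofReal_mul (by positivity), ENNReal.ofReal_mul (by positivity)]
  simp [mul_assoc]

theorem ofReal_exp_neg_le_lintegral {Ω : Type*} [MeasurableSpace Ω] {μ : Measure Ω}
    [IsProbabilityMeasure μ] {f : Ω → ℝ} (hf : Measurable f) (hf0 : ∀ ω, 0 ≤ f ω) {t : ℝ}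
    (ht : 0 ≤ t) (h : ∫⁻ ω, ENNReal.ofReal (f ω) ∂μ = ENNReal.ofReal t) :
    ENNReal.ofReal (exp (-t)) ≤ ∫⁻ ω, ENNReal.ofReal (exp (-f ω)) ∂μ := by
  have h1 : ∀ ω, ENNReal.ofReal (exp (-t)) + ENNReal.ofReal (exp (-t)) * ENNReal.ofReal t ≤
      ENNReal.ofReal (exp (-f ω)) + ENNReal.ofReal (exp (-t)) * ENNReal.ofReal (f ω) := by
    intro ω
    have h0 := hf0 ω
    rw [← ENNReal.ofReal_mul (exp_pos _).le, ← ENNReal.ofReal_mul (exp_pos _).le,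
      ← ENNReal.ofReal_add (by positivity) (by positivity),
      ← ENNReal.ofReal_add (by positivity) (by positivity)]
    refine ENNReal.ofReal_le_ofReal ?_
    have h2 : exp (-f ω) = exp (-t) * exp (t - f ω) := by rw [← exp_add]; ring_nf
    rw [h2]
    nlinarith [add_one_le_exp (t - f ω), exp_pos (-t)]
  have h2 := lintegral_mono (μ := μ) h1
  rw [lintegral_const, measure_univ, mul_one, lintegral_add_left (by fun_prop),
    lintegral_const_mul _ (by fun_prop), h] at h2
  exact (ENNReal.add_le_add_iff_right (by finiteness)).1 h2

/-- A common lower bound for the densities of the observations under the patterns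
`insert i R` and `insert l R`. -/
def pairDensity {n m J : ℕ} (s : ℝ) (R : Finset (Fin n)) (i l : Fin n)
    (z : (Fin J → Fin m → Fin n → ℝ) × (Fin J → Fin m → ℝ)) : ℝ≥0∞ :=
  ∫⁻ x, shiftDensity (meanObs s R x z.1) z.2 *
    ENNReal.ofReal (exp (-((entryEnergy s i x z.1 + entryEnergy s l x z.1) / 2))) ∂signalLaw J n

theorem le_lintegral_pairDensity {n m J : ℕ} (s : ℝ) (R : Finset (Fin n)) (i l : Fin n) :
    ENNReal.ofReal (exp (-(J * m * s ^ 2))) ≤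
      ∫⁻ z, pairDensity s R i l z ∂(matrixLaw J m n).prod (noiseLaw J m) := by
  have hEm : ∀ i, Measurable fun
      p : (Fin J → Fin n → ℝ) × (Fin J → Fin m → Fin n → ℝ) => entryEnergy s i p.1 p.2 := by
    intro i; unfold entryEnergy; fun_prop
  set q : (Fin J → Fin n → ℝ) × (Fin J → Fin m → Fin n → ℝ) → ℝ :=
    fun p => (entryEnergy s i p.1 p.2 + entryEnergy s l p.1 p.2) / 2 with hq
  have hqm : Measurable q := ((hEm i).add (hEm l)).div_const 2
  have hq0 : ∀ p, 0 ≤ q p := fun p => by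
    have := entryEnergy_nonneg s i p.1 p.2
    have := entryEnergy_nonneg s l p.1 p.2
    simp only [hq]; positivity
  have hqi : ∫⁻ p, ENNReal.ofReal (q p) ∂(signalLaw J n).prod (matrixLaw J m n) =
      ENNReal.ofReal (J * m * s ^ 2) := by
    have h : ∀ p, ENNReal.ofReal (q p) = ENNReal.ofReal 2⁻¹ *
        (ENNReal.ofReal (entryEnergy s i p.1 p.2) + ENNReal.ofReal (entryEnergy s l p.1 p.2)) := by
      intro p
      rw [← ENNReal.ofReal_add (entryEnergy_nonneg _ _ _ _) (entryEnergy_nonneg _ _ _ _),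
        ← ENNReal.ofReal_mul (by norm_num)]
      simp only [hq]; ring_nf
    simp_rw [h]
    have hi := (hEm i).ennreal_ofReal
    have hl := (hEm l).ennreal_ofReal
    rw [lintegral_const_mul _ (by fun_prop),
      lintegral_add_left (hEm i).ennreal_ofReal,
      lintegral_prod _ (hEm i).ennreal_ofReal.aemeasurable,
      lintegral_prod _ (hEm l).ennreal_ofReal.aemeasurable, lintegral_entryEnergy,
      lintegral_entryEnergy, ← ENNReal.ofReal_add (by positivity) (by positivity),
      ← ENNReal.ofReal_mul (by norm_num)]
    ring_nf
  have hm : Measurable (Function.uncurry fun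
      (z : (Fin J → Fin m → Fin n → ℝ) × (Fin J → Fin m → ℝ)) (x : Fin J → Fin n → ℝ) =>
      shiftDensity (meanObs s R x z.1) z.2 *
        ENNReal.ofReal (exp (-((entryEnergy s i x z.1 + entryEnergy s l x z.1) / 2)))) := by
    unfold Function.uncurry
    unfold entryEnergy
    fun_prop
  refine (ofReal_exp_neg_le_lintegral hqm hq0 (by positivity) hqi).trans_eq ?_
  unfold pairDensity
  rw [lintegral_lintegral_swap hm.aemeasurable, lintegral_prod _ (by fun_prop)]
  refine lintegral_congr fun x => ?_
  have hx : Measurable fun z : (Fin J → Fin m → Fin n → ℝ) × (Fin J → Fin m → ℝ) =>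
      shiftDensity (meanObs s R x z.1) z.2 *
        ENNReal.ofReal (exp (-((entryEnergy s i x z.1 + entryEnergy s l x z.1) / 2))) := by
    unfold entryEnergy
    fun_prop
  rw [lintegral_prod _ hx.aemeasurable]
  refine lintegral_congr fun a => ?_
  have ha : ∫⁻ y, shiftDensity (meanObs s R x a) y * ENNReal.ofReal (exp (-q (x, a)))
      ∂noiseLaw J m = ENNReal.ofReal (exp (-q (x, a))) := by
    rw [lintegral_mul_const _ (by fun_prop), lintegral_shiftDensity, one_mul]
  exact ha.symm

theorem measurable_pairDensity {n m J : ℕ} (s : ℝ) (R : Finset (Fin n)) (i l : Fin n) :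
    Measurable (pairDensity (m := m) (J := J) s R i l) := by
  unfold pairDensity
  refine Measurable.lintegral_prod_right ?_
  unfold Function.uncurry
  unfold entryEnergy
  fun_prop

theorem pairDensity_le_left {n m J : ℕ} (s : ℝ) {S : Finset (Fin n)} {i : Fin n} (hi : i ∈ S)
    (l : Fin n) (z : (Fin J → Fin m → Fin n → ℝ) × (Fin J → Fin m → ℝ)) :
    pairDensity s (S.erase i) i l z ≤ obsDensity s S z :=
  le_obsDensity s hi z fun x => le_add_of_nonneg_right (entryEnergy_nonneg s l x z.1)

theorem pairDensity_le_right {n m J : ℕ} (s : ℝ) {S : Finset (Fin n)} {i l : Fin n}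
    (hl : l ∉ S) (z : (Fin J → Fin m → Fin n → ℝ) × (Fin J → Fin m → ℝ)) :
    pairDensity s (S.erase i) i l z ≤ obsDensity s (insert l (S.erase i)) z := by
  have h := le_obsDensity s (mem_insert_self l (S.erase i)) z
    (Q := fun x => entryEnergy s i x z.1 + entryEnergy s l x z.1)
    fun x => le_add_of_nonneg_left (entryEnergy_nonneg s i x z.1)
  rwa [erase_insert fun h => hl (mem_of_mem_erase h)] at h

/-- Triples `(S, i, l)` with `S` a pattern, `i ∈ S` and `l ∉ S`. -/
def swapTriples (n k : ℕ) : Finset (Σ _ : Finset (Fin n), Fin n × Fin n) :=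
  (patterns n k).sigma fun S => S ×ˢ Sᶜ

theorem mem_swapTriples {n k : ℕ} {w : Σ _ : Finset (Fin n), Fin n × Fin n} :
    w ∈ swapTriples n k ↔ w.1.card = k ∧ w.2.1 ∈ w.1 ∧ w.2.2 ∉ w.1 := by
  simp [swapTriples, patterns]

theorem card_swapTriples (n k : ℕ) :
    (swapTriples n k).card = n.choose k * (k * (n - k)) := by
  have h : ∀ S ∈ patterns n k, (S ×ˢ Sᶜ).card = k * (n - k) := by
    intro S hS
    rw [patterns, mem_powersetCard_univ] at hS
    rw [card_product, card_compl, hS, Fintype.card_fin]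
  rw [swapTriples, card_sigma, sum_congr rfl h, sum_const, patterns, card_powersetCard]
  simp

theorem sum_swapTriples_swap {n k : ℕ} {M : Type*} [AddCommMonoid M]
    (F : (Σ _ : Finset (Fin n), Fin n × Fin n) → M) :
    ∑ w ∈ swapTriples n k, F ⟨insert w.2.2 (w.1.erase w.2.1), w.2.2, w.2.1⟩ =
      ∑ w ∈ swapTriples n k, F w := by
  have hmem : ∀ w ∈ swapTriples n k,
      (⟨insert w.2.2 (w.1.erase w.2.1), w.2.2, w.2.1⟩ : Σ _ : Finset (Fin n), Fin n × Fin n) ∈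
        swapTriples n k := by
    rintro ⟨S, i, l⟩ hw
    rw [mem_swapTriples] at hw ⊢
    obtain ⟨h1, h2, h3⟩ := hw
    dsimp only at h1 h2 h3 ⊢
    have h4 : i ≠ l := fun h => h3 (h ▸ h2)
    have h5 : 0 < S.card := card_pos.2 ⟨i, h2⟩
    refine ⟨?_, mem_insert_self _ _, by simp [h4]⟩
    rw [card_insert_of_notMem fun h => h3 (mem_of_mem_erase h), card_erase_of_mem h2]
    omega
  have hinv : ∀ w ∈ swapTriples n k,
      (⟨insert w.2.1 ((insert w.2.2 (w.1.erase w.2.1)).erase w.2.2), w.2.1, w.2.2⟩ :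
        Σ _ : Finset (Fin n), Fin n × Fin n) = w := by
    rintro ⟨S, i, l⟩ hw
    rw [mem_swapTriples] at hw
    obtain ⟨-, h2, h3⟩ := hw
    dsimp only at h2 h3 ⊢
    rw [erase_insert fun h => h3 (mem_of_mem_erase h), insert_erase h2]
  exact sum_nbij' (fun w => ⟨insert w.2.2 (w.1.erase w.2.1), w.2.2, w.2.1⟩)
    (fun w => ⟨insert w.2.2 (w.1.erase w.2.1), w.2.2, w.2.1⟩) hmem hmem hinv hinv fun _ _ => rfl

theorem sum_swapTriples_le {n k : ℕ} (T : Finset (Fin n)) {p : Finset (Fin n) → ℝ≥0∞}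
    {g : (Σ _ : Finset (Fin n), Fin n × Fin n) → ℝ≥0∞}
    (h1 : ∀ w ∈ swapTriples n k, g w ≤ p w.1)
    (h2 : ∀ w ∈ swapTriples n k, g w ≤ p (insert w.2.2 (w.1.erase w.2.1))) :
    ∑ w ∈ swapTriples n k, g w ≤
      2 * ∑ w ∈ swapTriples n k, if w.2.1 ∉ T ∨ w.2.2 ∈ T then p w.1 else 0 := by
  rw [two_mul]
  nth_rw 2 [← sum_swapTriples_swap]
  rw [← sum_add_distrib]
  refine sum_le_sum fun w hw => ?_
  dsimp only
  by_cases h : w.2.1 ∉ T ∨ w.2.2 ∈ T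
  · rw [if_pos h]
    exact (h1 w hw).trans le_add_self
  · rw [if_neg h, if_pos (by tauto), add_zero]
    exact h2 w hw

theorem card_swap_errors_le {n k : ℕ} {S : Finset (Fin n)} (T : Finset (Fin n))
    (hS : S.card = k) :
    ((S ×ˢ Sᶜ).filter fun q => q.1 ∉ T ∨ q.2 ∈ T).card ≤
      (S \ T).card * (n - k) + k * (T \ S).card := by
  have h : (S ×ˢ Sᶜ).filter (fun q => q.1 ∉ T ∨ q.2 ∈ T) ⊆
      (S \ T) ×ˢ Sᶜ ∪ S ×ˢ (T \ S) := by
    intro q hq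
    simp only [mem_filter, mem_product, mem_compl, mem_union, Finset.mem_sdiff] at hq ⊢
    tauto
  refine (card_le_card h).trans ((card_union_le _ _).trans_eq ?_)
  rw [card_product, card_product, card_compl, hS, Fintype.card_fin]

open Classical in
theorem sum_swap_errors_le {n k : ℕ} {α : ℝ} (hα : 0 ≤ α) (hk : 0 < k) (hkn : 2 * k ≤ n)
    (T : Finset (Fin n)) (p : Finset (Fin n) → ℝ≥0∞) :
    ∑ w ∈ swapTriples n k, (if w.2.1 ∉ T ∨ w.2.2 ∈ T then p w.1 else 0) ≤
      (k * (n - k) : ℕ) * ∑ S ∈ patterns n k,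
        ((if α < distor k S T then p S else 0) + ENNReal.ofReal (2 * α) * p S) := by
  rw [swapTriples, sum_sigma, mul_sum]
  refine sum_le_sum fun S hS => ?_
  rw [patterns, mem_powersetCard_univ] at hS
  dsimp only
  rw [← sum_filter, sum_const, nsmul_eq_mul]
  split_ifs with h
  · refine le_trans ?_ (mul_le_mul_right le_self_add _)
    gcongr
    refine (card_filter_le _ _).trans_eq ?_
    rw [card_product, card_compl, hS, Fintype.card_fin]
  · rw [zero_add, ← mul_assoc]
    gcongr
    rw [← ENNReal.ofReal_natCast, ← ENNReal.ofReal_natCast,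
      ← ENNReal.ofReal_mul (Nat.cast_nonneg _)]
    refine ENNReal.ofReal_le_ofReal ?_
    have hk' : (0 : ℝ) < k := by exact_mod_cast hk
    rw [not_lt, distor, div_le_iff₀ hk', max_le_iff] at h
    have hn : (k : ℝ) ≤ ((n - k : ℕ) : ℝ) := by exact_mod_cast (by omega : k ≤ n - k)
    have hc : (((S ×ˢ Sᶜ).filter fun q => q.1 ∉ T ∨ q.2 ∈ T).card : ℝ) ≤
        (S \ T).card * ((n - k : ℕ) : ℝ) + k * (T \ S).card := by
      exact_mod_cast card_swap_errors_le T hS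
    push_cast
    nlinarith [mul_le_mul_of_nonneg_right h.1 (hk'.le.trans hn),
      mul_le_mul_of_nonneg_left h.2 hk'.le, mul_nonneg (mul_nonneg hα hk'.le) (sub_nonneg.2 hn)]

theorem exp_le_errProb {n m J k : ℕ} {SNR α : ℝ} (hSNR : 0 ≤ SNR) (hα : 0 ≤ α) (hk : 0 < k)
    (hkn : 2 * k ≤ n) (est : Estimator n m J) :
    exp (-(J * m * (SNR / k))) ≤ 2 * errProb n m J k SNR α est + 4 * α := by
  classical
  set s := √(SNR / k) with hs
  have hs2 : s ^ 2 = SNR / k := Real.sq_sqrt (by positivity)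
  set ν := (matrixLaw J m n).prod (noiseLaw J m)
  set N : ℝ≥0∞ := ((k * (n - k) : ℕ) : ℝ≥0∞) with hN
  set P : Finset (Fin n) → ℝ≥0∞ := fun S => omegaLaw n m J
    {ω | α < distor k S (est (Yobs n m J SNR k S ω) ω.2.1)} with hP
  set D : Finset (Fin n) → Set ((Fin J → Fin m → Fin n → ℝ) × (Fin J → Fin m → ℝ)) :=
    fun S => {z | α < distor k S (est z.2 z.1)}
  choose h hhm hDh hhi using fun S =>
    exists_measurable_ge_indicator_obsDensity (k := k) SNR S (D S)
  have hpt : ∀ z, ∑ w ∈ swapTriples n k, pairDensity s (w.1.erase w.2.1) w.2.1 w.2.2 z ≤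
      2 * (N * ∑ S ∈ patterns n k, ((D S).indicator (obsDensity s S) z +
        ENNReal.ofReal (2 * α) * obsDensity s S z)) := by
    intro z
    refine (sum_swapTriples_le (est z.2 z.1) (p := fun S => obsDensity s S z)
      (fun w hw => pairDensity_le_left s (mem_swapTriples.1 hw).2.1 _ z)
      (fun w hw => pairDensity_le_right s (mem_swapTriples.1 hw).2.2 z)).trans ?_
    gcongr
    exact sum_swap_errors_le hα hk hkn _ _
  have hE : ENNReal.ofReal (exp (-(J * m * s ^ 2))) * (n.choose k * N) ≤
      2 * (N * ∑ S ∈ patterns n k, (P S + ENNReal.ofReal (2 * α))) := by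
    calc ENNReal.ofReal (exp (-(J * m * s ^ 2))) * (n.choose k * N)
        = ∑ w ∈ swapTriples n k, ENNReal.ofReal (exp (-(J * m * s ^ 2))) := by
          rw [sum_const, card_swapTriples, nsmul_eq_mul, mul_comm, hN]; push_cast; rfl
      _ ≤ ∑ w ∈ swapTriples n k, ∫⁻ z, pairDensity s (w.1.erase w.2.1) w.2.1 w.2.2 z ∂ν :=
          sum_le_sum fun w _ => le_lintegral_pairDensity s _ _ _
      _ ≤ ∫⁻ z, ∑ w ∈ swapTriples n k, pairDensity s (w.1.erase w.2.1) w.2.1 w.2.2 z ∂ν :=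
          (lintegral_finsetSum _ fun w _ => measurable_pairDensity _ _ _ _).ge
      _ ≤ ∫⁻ z, 2 * (N * ∑ S ∈ patterns n k, (h S z +
            ENNReal.ofReal (2 * α) * obsDensity s S z)) ∂ν := by
          refine lintegral_mono fun z => (hpt z).trans ?_
          gcongr with S
          exact hDh S z
      _ = _ := by
          have hom := fun S => measurable_obsDensity (m := m) (J := J) (n := n) s S
          rw [lintegral_const_mul _ (by fun_prop), lintegral_const_mul _ (by fun_prop),
            lintegral_finsetSum _ fun S _ => by fun_prop]
          congr 2
          refine sum_congr rfl fun S _ => ?_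
          rw [lintegral_add_left (hhm S), lintegral_const_mul _ (hom S), lintegral_obsDensity,
            mul_one, hhi S]
          rfl
  have hN0 : 0 < k * (n - k) := by
    have : 0 < n - k := by omega
    positivity
  have hC0 : 0 < n.choose k := Nat.choose_pos (by omega)
  have hPr : ∀ S, P S = ENNReal.ofReal (P S).toReal := fun S =>
    (ENNReal.ofReal_toReal (measure_ne_top _ _)).symm
  have hR : exp (-(J * m * s ^ 2)) * (n.choose k * (k * (n - k) : ℕ)) ≤
      2 * ((k * (n - k) : ℕ) * ∑ S ∈ patterns n k, ((P S).toReal + 2 * α)) := by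
    have h2 : 0 ≤ ∑ S ∈ patterns n k, ((P S).toReal + 2 * α) :=
      sum_nonneg fun S _ => by positivity
    rw [← ENNReal.ofReal_le_ofReal_iff (by positivity), ENNReal.ofReal_mul (by positivity),
      ENNReal.ofReal_mul (by positivity), ENNReal.ofReal_mul (by positivity),
      ENNReal.ofReal_mul (by positivity), ENNReal.ofReal_sum_of_nonneg fun S _ => by positivity,
      ENNReal.ofReal_natCast, ENNReal.ofReal_natCast, ENNReal.ofReal_ofNat]
    refine hE.trans_eq ?_
    congr 2
    exact sum_congr rfl fun S _ => by
      rw [ENNReal.ofReal_add (by positivity) (by positivity), ← hPr]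
  rw [sum_add_distrib, sum_const, patterns, card_powersetCard, card_univ, Fintype.card_fin,
    nsmul_eq_mul, hs2] at hR
  have hN1 : (0 : ℝ) < (k * (n - k) : ℕ) := by exact_mod_cast hN0
  have hC1 : (0 : ℝ) < n.choose k := by exact_mod_cast hC0
  refine le_of_mul_le_mul_right (hR.trans_eq ?_) (mul_pos hC1 hN1)
  rw [errProb, patterns]
  field_simp
  ring

theorem exp_le_of_achievable {κ SNR ρ α : ℝ} {J : ℕ} (hκ : κ ∈ Set.Ioo 0 (1 / 2))
    (hSNR : 0 ≤ SNR) (hα : 0 ≤ α) (h : achievable κ SNR ρ J α) :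
    exp (-(SNR * ρ / κ)) ≤ 4 * α := by
  obtain ⟨k, m, est, hk, hm, herr⟩ := h
  have h1 : Tendsto (fun n : ℕ => exp (-(SNR * (J * m n / n) / (k n / n)))) atTop
      (𝓝 (exp (-(SNR * ρ / κ)))) :=
    (continuous_exp.tendsto _).comp (((hm.const_mul SNR).div hk hκ.1.ne').neg)
  have h2 : Tendsto (fun n => 2 * errProb n (m n) J (k n) SNR α (est n) + 4 * α) atTop
      (𝓝 (4 * α)) := by
    simpa using (herr.const_mul 2).add_const (4 * α)
  refine le_of_tendsto_of_tendsto h1 h2 ?_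
  filter_upwards [hk.eventually (lt_mem_nhds hκ.1), hk.eventually (gt_mem_nhds hκ.2),
    eventually_gt_atTop 0] with n hn1 hn2 hn0
  have hn0' : (0 : ℝ) < n := by exact_mod_cast hn0
  have hk0 : 0 < k n := by
    rw [Nat.pos_iff_ne_zero]; rintro hk0; simp [hk0] at hn1
  have hk0' : (0 : ℝ) < k n := by exact_mod_cast hk0
  have hkn : 2 * k n ≤ n := by
    rw [div_lt_iff₀ hn0'] at hn2
    have : (2 * k n : ℝ) ≤ n := by linarith
    exact_mod_cast this
  refine le_trans (le_of_eq ?_) (exp_le_errProb hSNR hα hk0 hkn (est n))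
  congr 2
  field_simp

theorem log_le_of_achievable {κ SNR ρ α : ℝ} {J : ℕ} (hκ : κ ∈ Set.Ioo 0 (1 / 2))
    (hSNR : 0 < SNR) (hα : 0 < α) (hα' : α ≤ 1 / 16) (h : achievable κ SNR ρ J α) :
    κ / (2 * SNR) * log (1 / α) ≤ ρ := by
  have h1 := log_le_log (exp_pos _) (exp_le_of_achievable hκ hSNR.le hα.le h)
  have h2 : log 16 ≤ log (1 / α) := log_le_log (by norm_num) (by
    rw [le_div_iff₀ hα]; linarith)
  have h3 : log 16 = 2 * log 4 := by
    rw [show (16 : ℝ) = 4 ^ 2 by norm_num, log_pow]; norm_num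
  rw [log_exp, log_mul (by norm_num) hα.ne'] at h1
  rw [one_div, log_inv] at h2 ⊢
  have h4 : -log α / 2 ≤ SNR * ρ / κ := by linarith
  have hκ0 := hκ.1
  rw [le_div_iff₀ hκ0] at h4
  rw [div_mul_eq_mul_div, div_le_iff₀ (by positivity)]
  linarith

theorem gaussianPi_map_linear {ι : Type*} [Fintype ι] (p : ι → ℝ) :
    (gaussianPi ι).map (fun g => ∑ i, p i * g i) = stdGaussian.map fun x => √(∑ i, p i ^ 2) * x := by
  have hv : (0 : ℝ) ≤ ∑ i, p i ^ 2 := sum_nonneg fun _ _ => sq_nonneg _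
  have h1 : Measurable fun g : ι → ℝ => ∑ i, p i * g i := by fun_prop
  have hpm := Measure.isProbabilityMeasure_map (μ := gaussianPi ι) h1.aemeasurable
  rw [stdGaussian, gaussianReal_map_const_mul]
  refine Measure.ext_of_charFun ?_
  ext t
  rw [charFun_gaussianReal, charFun_apply_real, integral_map h1.aemeasurable (by fun_prop)]
  have h2 : ∀ g : ι → ℝ, Complex.exp (t * (∑ i, p i * g i : ℝ) * Complex.I) =
      ∏ i, Complex.exp ((t * p i : ℝ) * (g i) * Complex.I) := by
    intro g
    rw [← Complex.exp_sum]
    push_cast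
    rw [mul_sum, sum_mul]
    congr 1
    exact sum_congr rfl fun i _ => by ring
  simp_rw [h2]
  rw [gaussianPi, integral_fintype_prod_eq_prod
    (f := fun i (x : ℝ) => Complex.exp ((t * p i : ℝ) * x * Complex.I))]
  simp_rw [stdGaussian, ← charFun_apply_real, charFun_gaussianReal]
  rw [← Complex.exp_sum]
  congr 1
  simp only [mul_zero, Complex.ofReal_zero, zero_mul, zero_sub, NNReal.coe_one,
    Complex.ofReal_one, one_mul, mul_one, NNReal.coe_mk, Real.sq_sqrt hv]
  push_cast
  rw [sum_neg_distrib, ← sum_div, sum_mul]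
  congr 2
  exact sum_congr rfl fun i _ => by ring

theorem inv_sqrt_one_sub_le {x : ℝ} (hx : x ≤ 1 / 2) : (√(1 - x))⁻¹ ≤ exp (x / 2 + x ^ 2) := by
  have h0 : 0 < 1 - x := by linarith
  rw [inv_le_comm₀ (by positivity) (exp_pos _), ← exp_neg]
  refine le_sqrt_of_sq_le ?_
  rw [← exp_nat_mul]
  have h1 : 1 ≤ (1 - x) * exp (x + 2 * x ^ 2) := by
    nlinarith [add_one_le_exp (x + 2 * x ^ 2), mul_nonneg (sq_nonneg x) (sub_nonneg.2 hx)]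
  have h2 : exp ((2 : ℕ) * -(x / 2 + x ^ 2)) = (exp (x + 2 * x ^ 2))⁻¹ := by
    rw [← exp_neg]; push_cast; ring_nf
  rw [h2, inv_le_iff_one_le_mul₀ (exp_pos _)]
  exact h1

theorem lintegral_exp_mul_sq_stdGaussian {b : ℝ} (hb : b < 1 / 2) :
    ∫⁻ x, ENNReal.ofReal (exp (b * x ^ 2)) ∂stdGaussian =
      ENNReal.ofReal (√(1 - 2 * b))⁻¹ := by
  have hc : 0 < 1 / 2 - b := by linarith
  have h1 : ∀ x, gaussianPDF 0 1 x * ENNReal.ofReal (exp (b * x ^ 2)) =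
      ENNReal.ofReal ((√(2 * π))⁻¹ * exp (-(1 / 2 - b) * x ^ 2)) := by
    intro x
    rw [gaussianPDF, ← ENNReal.ofReal_mul (gaussianPDFReal_nonneg _ _ _), gaussianPDFReal, mul_assoc,
      ← exp_add]
    simp only [NNReal.coe_one, mul_one, sub_zero]
    ring_nf
  rw [stdGaussian, gaussianReal_of_var_ne_zero _ one_ne_zero,
    lintegral_withDensity_eq_lintegral_mul _ (measurable_gaussianPDF _ _) (by fun_prop)]
  simp only [Pi.mul_apply, h1]
  rw [← ofReal_integral_eq_lintegral_ofReal ((integrable_exp_neg_mul_sq hc).const_mul _)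
    (ae_of_all _ fun x => by positivity), integral_const_mul, integral_gaussian, ← sqrt_inv,
    ← sqrt_inv, ← sqrt_mul (by positivity)]
  congr 2
  have := pi_pos
  have : 1 - 2 * b ≠ 0 := by linarith
  field_simp

theorem lintegral_exp_mul_sq_sub_le {ι : Type*} [Fintype ι] (p : ι → ℝ) {b v : ℝ}
    (hp : ∑ i, p i ^ 2 ≤ v) (hb : |b| * v ≤ 1 / 4) :
    ∫⁻ g, ENNReal.ofReal (exp (b * ((∑ i, p i * g i) ^ 2 - ∑ i, p i ^ 2))) ∂gaussianPi ι ≤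
      ENNReal.ofReal (exp (4 * (b * v) ^ 2)) := by
  set w := ∑ i, p i ^ 2 with hw
  have hw0 : 0 ≤ w := sum_nonneg fun _ _ => sq_nonneg _
  have hbw : |b * w| ≤ |b| * v := by
    rw [abs_mul, abs_of_nonneg hw0]; gcongr
  have hbw' : b * w ≤ 1 / 4 := (le_abs_self _).trans (hbw.trans hb)
  have hF : Measurable fun y : ℝ => ENNReal.ofReal (exp (b * (y ^ 2 - w))) := by fun_prop
  have h1 : ∫⁻ g, ENNReal.ofReal (exp (b * ((∑ i, p i * g i) ^ 2 - w))) ∂gaussianPi ι =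
      ∫⁻ x, ENNReal.ofReal (exp (b * ((√w * x) ^ 2 - w))) ∂stdGaussian := by
    rw [← lintegral_map (f := fun y : ℝ => ENNReal.ofReal (exp (b * (y ^ 2 - w)))) hF
      (g := fun g : ι → ℝ => ∑ i, p i * g i) (by fun_prop), gaussianPi_map_linear,
      lintegral_map hF (by fun_prop)]
  have h2 : ∀ x, ENNReal.ofReal (exp (b * ((√w * x) ^ 2 - w))) =
      ENNReal.ofReal (exp (-(b * w))) * ENNReal.ofReal (exp ((b * w) * x ^ 2)) := by
    intro x
    rw [← ENNReal.ofReal_mul (exp_pos _).le, ← exp_add, mul_pow, Real.sq_sqrt hw0]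
    ring_nf
  rw [h1]
  simp_rw [h2]
  rw [lintegral_const_mul _ (by fun_prop), lintegral_exp_mul_sq_stdGaussian (by linarith),
    ← ENNReal.ofReal_mul (exp_pos _).le]
  refine ENNReal.ofReal_le_ofReal ?_
  calc _ ≤ exp (-(b * w)) * exp (2 * (b * w) / 2 + (2 * (b * w)) ^ 2) := by
        gcongr
        exact inv_sqrt_one_sub_le (by linarith)
    _ = exp (4 * (b * w) ^ 2) := by rw [← exp_add]; ring_nf
    _ ≤ _ := by
        rw [exp_le_exp]
        have : (b * w) ^ 2 ≤ (b * v) ^ 2 := by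
          rw [sq_le_sq, abs_mul b v, abs_of_nonneg (hw0.trans hp)]
          exact hbw
        linarith

theorem two_mul_exp_add_le (x y : ℝ) : 2 * exp (x + y) ≤ exp (2 * x) + exp (2 * y) := by
  have h := two_mul_exp_le (x + y) (x - y)
  ring_nf at h ⊢
  linarith

theorem lintegral_exp_chaos_le_of_le {ι : Type*} [Fintype ι] (c e : ι → ℝ) {θ T : ℝ}
    (hc : ∑ i, c i ^ 2 ≤ T) (he : ∑ i, e i ^ 2 ≤ T) (hθ : |θ| * T ≤ 1 / 8) :
    ∫⁻ g, ENNReal.ofReal (exp (θ * ((∑ i, c i * g i) * (∑ i, e i * g i) - ∑ i, c i * e i)))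
      ∂gaussianPi ι ≤ ENNReal.ofReal (exp (16 * (θ * T) ^ 2)) := by
  have hsum : ∑ i, (c i + e i) ^ 2 + ∑ i, (c i - e i) ^ 2 ≤ 4 * T := by
    have : ∑ i, (c i + e i) ^ 2 + ∑ i, (c i - e i) ^ 2 = 2 * ∑ i, c i ^ 2 + 2 * ∑ i, e i ^ 2 := by
      simp only [mul_sum, ← sum_add_distrib]
      exact sum_congr rfl fun i _ => by ring
    linarith
  have hp0 : 0 ≤ ∑ i, (c i + e i) ^ 2 := sum_nonneg fun _ _ => sq_nonneg _
  have hq0 : 0 ≤ ∑ i, (c i - e i) ^ 2 := sum_nonneg fun _ _ => sq_nonneg _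
  have hb : |θ / 2| * (4 * T) ≤ 1 / 4 := by
    rw [abs_div, abs_two]; linarith
  have h1 := lintegral_exp_mul_sq_sub_le (fun i => c i + e i) (b := θ / 2) (v := 4 * T)
    (by linarith) hb
  have h2 := lintegral_exp_mul_sq_sub_le (fun i => c i - e i) (b := -(θ / 2)) (v := 4 * T)
    (by linarith) (by rwa [abs_neg])
  have h3 : ∀ g : ι → ℝ,
      2 * ENNReal.ofReal (exp (θ * ((∑ i, c i * g i) * (∑ i, e i * g i) - ∑ i, c i * e i))) ≤
      ENNReal.ofReal (exp (θ / 2 *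
        ((∑ i, (c i + e i) * g i) ^ 2 - ∑ i, (c i + e i) ^ 2))) +
      ENNReal.ofReal (exp (-(θ / 2) *
        ((∑ i, (c i - e i) * g i) ^ 2 - ∑ i, (c i - e i) ^ 2))) := by
    intro g
    rw [← ENNReal.ofReal_add (exp_pos _).le (exp_pos _).le, ← ENNReal.ofReal_ofNat 2,
      ← ENNReal.ofReal_mul zero_le_two]
    refine ENNReal.ofReal_le_ofReal (le_trans (le_of_eq ?_) ((two_mul_exp_add_le
      (θ / 4 * ((∑ i, (c i + e i) * g i) ^ 2 - ∑ i, (c i + e i) ^ 2))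
      (-(θ / 4) * ((∑ i, (c i - e i) * g i) ^ 2 - ∑ i, (c i - e i) ^ 2))).trans_eq (by ring_nf)))
    have e1 : ∑ i, (c i + e i) * g i = ∑ i, c i * g i + ∑ i, e i * g i := by
      rw [← sum_add_distrib]; exact sum_congr rfl fun i _ => by ring
    have e2 : ∑ i, (c i - e i) * g i = ∑ i, c i * g i - ∑ i, e i * g i := by
      rw [← sum_sub_distrib]; exact sum_congr rfl fun i _ => by ring
    have e3 : ∑ i, (c i + e i) ^ 2 = ∑ i, (c i - e i) ^ 2 + 4 * ∑ i, c i * e i := by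
      rw [mul_sum, ← sum_add_distrib]; exact sum_congr rfl fun i _ => by ring
    rw [e1, e2, e3]
    ring_nf
  have h4 := lintegral_mono (μ := gaussianPi ι) h3
  rw [lintegral_const_mul _ (by fun_prop), lintegral_add_left (by fun_prop)] at h4
  refine (ENNReal.mul_le_mul_iff_right (two_ne_zero) (by simp)).1 (h4.trans ((add_le_add h1 h2).trans_eq ?_))
  rw [two_mul]
  ring_nf

theorem lintegral_exp_chaos_le {ι : Type*} [Fintype ι] (c e : ι → ℝ) {θ T t : ℝ} (ht : 0 < t)
    (hc : t * ∑ i, c i ^ 2 ≤ T) (he : ∑ i, e i ^ 2 ≤ T * t) (hθ : |θ| * T ≤ 1 / 8) :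
    ∫⁻ g, ENNReal.ofReal (exp (θ * ((∑ i, c i * g i) * (∑ i, e i * g i) - ∑ i, c i * e i)))
      ∂gaussianPi ι ≤ ENNReal.ofReal (exp (16 * (θ * T) ^ 2)) := by
  have hs : √t ^ 2 = t := Real.sq_sqrt ht.le
  have hs0 : 0 < √t := Real.sqrt_pos.2 ht
  have h := lintegral_exp_chaos_le_of_le (fun i => √t * c i) (fun i => e i / √t) (θ := θ) (T := T)
    (by simp_rw [mul_pow, hs, ← mul_sum]; exact hc)
    (by simp_rw [div_pow, hs, ← sum_div]; rwa [div_le_iff₀ ht]) hθ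
  refine le_trans (le_of_eq ?_) h
  refine lintegral_congr fun g => ?_
  have e1 : ∑ i, √t * c i * g i = √t * ∑ i, c i * g i := by
    rw [mul_sum]; exact sum_congr rfl fun i _ => by ring
  have e2 : ∑ i, e i / √t * g i = (∑ i, e i * g i) / √t := by
    rw [sum_div]; exact sum_congr rfl fun i _ => by ring
  have e3 : ∑ i, √t * c i * (e i / √t) = ∑ i, c i * e i :=
    sum_congr rfl fun i _ => by field_simp
  rw [e1, e2, e3]
  field_simp

theorem lintegral_exp_neg_abs_stdGaussian_le {t : ℝ} (ht : 0 < t) :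
    ∫⁻ x, ENNReal.ofReal (exp (-(t * |x|))) ∂stdGaussian ≤ ENNReal.ofReal (4 / t) := by
  have h1 : ∀ x, gaussianPDF 0 1 x * ENNReal.ofReal (exp (-(t * |x|))) ≤
      ENNReal.ofReal ((1 + (t * x) ^ 2)⁻¹) := by
    intro x
    rw [gaussianPDF, ← ENNReal.ofReal_mul (gaussianPDFReal_nonneg _ _ _)]
    refine ENNReal.ofReal_le_ofReal ?_
    have h2 : gaussianPDFReal 0 1 x ≤ 1 / 2 := by
      rw [gaussianPDFReal]
      have h3 : (√(2 * π * (1 : ℝ≥0)))⁻¹ ≤ 1 / 2 := by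
        rw [one_div]
        gcongr
        refine le_sqrt_of_sq_le ?_
        have := pi_gt_three
        simp only [NNReal.coe_one, mul_one]
        linarith
      have h4 : exp (-(x - 0) ^ 2 / (2 * (1 : ℝ≥0))) ≤ 1 := by
        rw [exp_le_one_iff]
        have := sq_nonneg (x - 0)
        simp only [NNReal.coe_one, mul_one]
        linarith
      calc _ ≤ 1 / 2 * (1 : ℝ) := mul_le_mul h3 h4 (exp_pos _).le (by norm_num)
        _ = _ := mul_one _
    have h5 : exp (-(t * |x|)) ≤ 2 * (1 + (t * x) ^ 2)⁻¹ := by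
      rw [exp_neg, ← div_eq_mul_inv, inv_le_comm₀ (exp_pos _) (by positivity), inv_div]
      have h6 := quadratic_le_exp_of_nonneg (x := t * |x|) (by positivity)
      have h7 : (t * |x|) ^ 2 = (t * x) ^ 2 := by rw [mul_pow, sq_abs, mul_pow]
      have h8 : 0 ≤ t * |x| := by positivity
      rw [h7] at h6
      linarith
    calc _ ≤ 1 / 2 * (2 * (1 + (t * x) ^ 2)⁻¹) := by gcongr
      _ = _ := by ring
  have hi : Integrable fun x : ℝ => (1 + (t * x) ^ 2)⁻¹ :=
    integrable_inv_one_add_sq.comp_mul_left' ht.ne'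
  rw [stdGaussian, gaussianReal_of_var_ne_zero _ one_ne_zero,
    lintegral_withDensity_eq_lintegral_mul _ (measurable_gaussianPDF _ _) (by fun_prop)]
  refine (lintegral_mono h1).trans ?_
  rw [← ofReal_integral_eq_lintegral_ofReal hi (ae_of_all _ fun x => by positivity),
    Measure.integral_comp_mul_left (fun x : ℝ => (1 + x ^ 2)⁻¹), integral_univ_inv_one_add_sq]
  refine ENNReal.ofReal_le_ofReal ?_
  rw [abs_of_pos (inv_pos.2 ht), smul_eq_mul, mul_comm, ← div_eq_mul_inv]
  gcongr
  exact pi_le_four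

theorem lintegral_exp_quarter_sq_stdGaussian_le :
    ∫⁻ x, ENNReal.ofReal (exp (1 / 4 * x ^ 2)) ∂stdGaussian ≤ ENNReal.ofReal (exp (1 / 2)) := by
  rw [lintegral_exp_mul_sq_stdGaussian (by norm_num)]
  refine ENNReal.ofReal_le_ofReal ((inv_sqrt_one_sub_le (by norm_num)).trans ?_)
  norm_num

theorem lintegral_signalLaw_prod {J n : ℕ} {f : Fin J → Fin n → ℝ → ℝ≥0∞}
    (hf : ∀ j i, Measurable (f j i)) :
    ∫⁻ x, ∏ j, ∏ i, f j i (x j i) ∂signalLaw J n = ∏ j, ∏ i, ∫⁻ y, f j i y ∂stdGaussian := by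
  rw [signalLaw, lintegral_pi_prod (fun _ : Fin J => gaussianPi (Fin n))
    (f := fun j x => ∏ i, f j i (x i)) fun j => by fun_prop]
  refine prod_congr rfl fun j _ => ?_
  exact lintegral_pi_prod (fun _ : Fin n => stdGaussian) (hf j)

theorem lintegral_matrixLaw_prod {J m n : ℕ} {f : Fin J → Fin m → (Fin n → ℝ) → ℝ≥0∞}
    (hf : ∀ j r, Measurable (f j r)) :
    ∫⁻ a, ∏ j, ∏ r, f j r (a j r) ∂matrixLaw J m n =
      ∏ j, ∏ r, ∫⁻ g, f j r g ∂gaussianPi (Fin n) := by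
  rw [matrixLaw, lintegral_pi_prod (fun _ : Fin J => Measure.pi fun _ : Fin m => gaussianPi (Fin n))
    (f := fun j x => ∏ r, f j r (x r)) fun j => by fun_prop]
  refine prod_congr rfl fun j _ => ?_
  exact lintegral_pi_prod (fun _ : Fin m => gaussianPi (Fin n)) (hf j)

/-- Chernoff weight of the event that the total amplitude of the entries in `D` is small. -/
def smallWeight {J n : ℕ} (δ : ℝ) (D : Finset (Fin n)) (x : Fin J → Fin n → ℝ) : ℝ :=
  exp (∑ j, ∑ i ∈ D, (1 - |x j i| / (2 * δ)))

theorem lintegral_smallWeight_le {J n : ℕ} {δ : ℝ} (hδ : 0 < δ) (D : Finset (Fin n)) :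
    ∫⁻ x, ENNReal.ofReal (smallWeight δ D x) ∂signalLaw J n ≤
      ENNReal.ofReal (exp 1 * (8 * δ)) ^ (J * D.card) := by
  have h1 : ∀ x : Fin J → Fin n → ℝ, ENNReal.ofReal (smallWeight δ D x) =
      ∏ j, ∏ i, (fun y : ℝ => if i ∈ D then
        ENNReal.ofReal (exp 1) * ENNReal.ofReal (exp (-((2 * δ)⁻¹ * |y|))) else 1) (x j i) := by
    intro x
    rw [smallWeight, exp_sum, ENNReal.ofReal_prod_of_nonneg fun _ _ => (exp_pos _).le]
    refine prod_congr rfl fun j _ => ?_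
    rw [exp_sum, ENNReal.ofReal_prod_of_nonneg fun _ _ => (exp_pos _).le, prod_ite_mem, univ_inter]
    refine prod_congr rfl fun i _ => ?_
    rw [← ENNReal.ofReal_mul (exp_pos _).le, ← exp_add]
    ring_nf
  simp_rw [h1]
  rw [lintegral_signalLaw_prod (f := fun _ i y => if i ∈ D then
    ENNReal.ofReal (exp 1) * ENNReal.ofReal (exp (-((2 * δ)⁻¹ * |y|))) else 1)
    fun j i => by split_ifs <;> fun_prop]
  have h2 : ∀ i, ∫⁻ y, (if i ∈ D then ENNReal.ofReal (exp 1) *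
      ENNReal.ofReal (exp (-((2 * δ)⁻¹ * |y|))) else 1) ∂stdGaussian ≤
      if i ∈ D then ENNReal.ofReal (exp 1 * (8 * δ)) else 1 := by
    intro i
    split_ifs
    · rw [lintegral_const_mul _ (by fun_prop), ENNReal.ofReal_mul (exp_pos _).le]
      gcongr
      refine (lintegral_exp_neg_abs_stdGaussian_le (by positivity)).trans_eq ?_
      congr 1
      field_simp
      norm_num
    · simp
  refine (prod_le_prod' fun j _ => prod_le_prod' fun i _ => h2 i).trans_eq ?_
  simp only [prod_const, prod_ite_mem, univ_inter, card_univ, Fintype.card_fin]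
  rw [← pow_mul, mul_comm D.card]

/-- Chernoff weight of the event that the energy of the `j`-th signal is large. -/
def energyWeight {J n : ℕ} (S : Finset (Fin n)) (j : Fin J) (x : Fin J → Fin n → ℝ) : ℝ :=
  exp (∑ i ∈ S, (1 / 4 * x j i ^ 2 - 1))

theorem lintegral_energyWeight_le {J n : ℕ} (S : Finset (Fin n)) (j : Fin J) :
    ∫⁻ x, ENNReal.ofReal (energyWeight S j x) ∂signalLaw J n ≤
      ENNReal.ofReal (exp (-(S.card / 2))) := by
  have h1 : ∀ x : Fin J → Fin n → ℝ, ENNReal.ofReal (energyWeight S j x) =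
      ∏ j', ∏ i, (fun y : ℝ => if j' = j ∧ i ∈ S then
        ENNReal.ofReal (exp (-1)) * ENNReal.ofReal (exp (1 / 4 * y ^ 2)) else 1) (x j' i) := by
    intro x
    rw [energyWeight, exp_sum, ENNReal.ofReal_prod_of_nonneg fun _ _ => (exp_pos _).le,
      prod_eq_single j (fun j' _ h => by simp [h]) (by simp)]
    simp only [true_and, prod_ite_mem, univ_inter]
    refine prod_congr rfl fun i _ => ?_
    rw [← ENNReal.ofReal_mul (exp_pos _).le, ← exp_add]
    ring_nf
  simp_rw [h1]
  rw [lintegral_signalLaw_prod (f := fun j' i y => if j' = j ∧ i ∈ S then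
    ENNReal.ofReal (exp (-1)) * ENNReal.ofReal (exp (1 / 4 * y ^ 2)) else 1)
    fun j i => by split_ifs <;> fun_prop]
  have h2 : ∀ j' i, ∫⁻ y, (if j' = j ∧ i ∈ S then ENNReal.ofReal (exp (-1)) *
      ENNReal.ofReal (exp (1 / 4 * y ^ 2)) else 1) ∂stdGaussian ≤
      if j' = j ∧ i ∈ S then ENNReal.ofReal (exp (-(1 / 2))) else 1 := by
    intro j' i
    split_ifs
    · rw [lintegral_const_mul _ (by fun_prop), show -(1 / 2 : ℝ) = -1 + 1 / 2 by norm_num, exp_add,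
        ENNReal.ofReal_mul (exp_pos _).le]
      gcongr
      exact lintegral_exp_quarter_sq_stdGaussian_le
    · simp
  refine (prod_le_prod' fun j' _ => prod_le_prod' fun i _ => h2 j' i).trans_eq ?_
  rw [prod_eq_single j (fun j' _ h => by simp [h]) (by simp)]
  simp only [true_and, prod_ite_mem, univ_inter, prod_const]
  rw [← ENNReal.ofReal_pow (exp_pos _).le, ← exp_nat_mul]
  congr 2
  ring

theorem lintegral_noiseLaw_exp {J m : ℕ} (u c : Fin J → Fin m → ℝ) :
    ∫⁻ w, ENNReal.ofReal (exp (∑ j, ∑ r, (u j r * w j r + c j r))) ∂noiseLaw J m =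
      ENNReal.ofReal (exp (∑ j, ∑ r, (u j r ^ 2 / 2 + c j r))) := by
  have h : ∀ w : Fin J → Fin m → ℝ, ENNReal.ofReal (exp (∑ j, ∑ r, (u j r * w j r + c j r))) =
      shiftDensity u w * ENNReal.ofReal (exp (∑ j, ∑ r, (u j r ^ 2 / 2 + c j r))) := by
    intro w
    rw [shiftDensity, ← ENNReal.ofReal_mul (exp_pos _).le, ← exp_add]
    simp only [← sum_add_distrib]
    congr 2
    exact sum_congr rfl fun j _ => sum_congr rfl fun r _ => by ring
  simp_rw [h]
  rw [lintegral_mul_const _ (measurable_shiftDensity u), lintegral_shiftDensity, one_mul]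

/-- The centered correlation of the observations with the columns of the matrices, summed against
the coefficients `v`. -/
def crossCorr {n m J : ℕ} (s : ℝ) (S : Finset (Fin n)) (v : Fin J → Fin n → ℝ)
    (x : Fin J → Fin n → ℝ) (a : Fin J → Fin m → Fin n → ℝ) (w : Fin J → Fin m → ℝ) : ℝ :=
  ∑ j, ∑ r, ((∑ i, v j i * a j r i) * (meanObs s S x a j r + w j r) -
    s * ∑ i, v j i * ((if i ∈ S then 1 else 0) * x j i))

theorem lintegral_exp_crossCorr_le {n m J : ℕ} {s τ d T t : ℝ} (hs : 0 < s) (hτ : 0 < τ)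
    (ht : 0 < t) (S : Finset (Fin n)) {v x : Fin J → Fin n → ℝ} (hv : ∀ j, ∑ i, v j i ^ 2 = d)
    (hdT : t * d ≤ T)
    (hx : ∀ j, ∑ i, ((if i ∈ S then 1 else 0) * x j i + τ / (2 * s) * v j i) ^ 2 ≤ T * t)
    (hT : τ * s * T ≤ 1 / 8) :
    ∫⁻ z, ENNReal.ofReal (exp (τ * crossCorr s S v x z.1 z.2))
        ∂(matrixLaw J m n).prod (noiseLaw J m) ≤
      ENNReal.ofReal (exp (J * m * (16 * (τ * s * T) ^ 2 + τ ^ 2 * d / 2))) := by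
  set e : Fin J → Fin n → ℝ :=
    fun j i => (if i ∈ S then 1 else 0) * x j i + τ / (2 * s) * v j i with he
  have hm : Measurable fun z : (Fin J → Fin m → Fin n → ℝ) × (Fin J → Fin m → ℝ) =>
      ENNReal.ofReal (exp (τ * crossCorr s S v x z.1 z.2)) := by
    unfold crossCorr meanObs; fun_prop
  have hw : ∀ a : Fin J → Fin m → Fin n → ℝ,
      ∫⁻ w, ENNReal.ofReal (exp (τ * crossCorr s S v x a w)) ∂noiseLaw J m =
      ∏ j, ∏ r, (fun g : Fin n → ℝ => ENNReal.ofReal (exp (τ ^ 2 * d / 2)) * ENNReal.ofReal (exp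
        (τ * s * ((∑ i, v j i * g i) * (∑ i, e j i * g i) - ∑ i, v j i * e j i)))) (a j r) := by
    intro a
    have h1 : ∀ w : Fin J → Fin m → ℝ, τ * crossCorr s S v x a w =
        ∑ j, ∑ r, (τ * (∑ i, v j i * a j r i) * w j r +
          τ * ((∑ i, v j i * a j r i) * meanObs s S x a j r -
            s * ∑ i, v j i * ((if i ∈ S then 1 else 0) * x j i))) := by
      intro w
      rw [crossCorr, mul_sum]
      refine sum_congr rfl fun j _ => ?_
      rw [mul_sum]
      exact sum_congr rfl fun r _ => by ring
    simp_rw [h1]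
    rw [lintegral_noiseLaw_exp (fun j r => τ * (∑ i, v j i * a j r i)), exp_sum,
      ENNReal.ofReal_prod_of_nonneg fun _ _ => (exp_pos _).le]
    refine prod_congr rfl fun j _ => ?_
    rw [exp_sum, ENNReal.ofReal_prod_of_nonneg fun _ _ => (exp_pos _).le]
    refine prod_congr rfl fun r _ => ?_
    rw [← ENNReal.ofReal_mul (exp_pos _).le, ← exp_add]
    have h2 : ∑ i, e j i * a j r i = (∑ i, a j r i * ((if i ∈ S then 1 else 0) * x j i)) +
        τ / (2 * s) * ∑ i, v j i * a j r i := by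
      rw [mul_sum, ← sum_add_distrib]
      exact sum_congr rfl fun i _ => by simp only [he]; ring
    have h3 : ∑ i, v j i * e j i = (∑ i, v j i * ((if i ∈ S then 1 else 0) * x j i)) +
        τ / (2 * s) * d := by
      rw [← hv j, mul_sum, ← sum_add_distrib]
      exact sum_congr rfl fun i _ => by simp only [he]; ring
    rw [h2, h3, meanObs]
    congr 2
    field_simp
    ring
  rw [lintegral_prod _ hm.aemeasurable]
  simp_rw [hw]
  rw [lintegral_matrixLaw_prod (f := fun j _ g => ENNReal.ofReal (exp (τ ^ 2 * d / 2)) *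
    ENNReal.ofReal (exp (τ * s * ((∑ i, v j i * g i) * (∑ i, e j i * g i) - ∑ i, v j i * e j i))))
    fun j r => by fun_prop]
  have h4 : ∀ j, ∫⁻ g, ENNReal.ofReal (exp (τ ^ 2 * d / 2)) * ENNReal.ofReal (exp
      (τ * s * ((∑ i, v j i * g i) * (∑ i, e j i * g i) - ∑ i, v j i * e j i)))
      ∂gaussianPi (Fin n) ≤
      ENNReal.ofReal (exp (16 * (τ * s * T) ^ 2 + τ ^ 2 * d / 2)) := by
    intro j
    rw [lintegral_const_mul _ (by fun_prop), add_comm, exp_add,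
      ENNReal.ofReal_mul (exp_pos _).le]
    gcongr
    exact lintegral_exp_chaos_le (v j) (e j) ht (by rwa [hv]) (hx j)
      (by rwa [abs_of_pos (mul_pos hτ hs)])
  refine (prod_le_prod' fun j _ => prod_le_prod' fun r _ => h4 j).trans_eq ?_
  simp only [prod_const, card_univ, Fintype.card_fin]
  rw [← pow_mul, ← ENNReal.ofReal_pow (exp_pos _).le, ← exp_nat_mul]
  congr 2
  push_cast
  ring

/-- Select the columns having large total correlation with the observations. -/
def corrEstimator (n m J : ℕ) (t : ℝ) : Estimator n m J :=
  fun y a => univ.filter fun i => t < ∑ j, |∑ r, a j r i * y j r|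

/-- The deviation of the correlation of the observations with a column of the matrix from its
conditional mean given the signal. -/
def corrDev {n m J : ℕ} (s : ℝ) (S : Finset (Fin n)) (x : Fin J → Fin n → ℝ)
    (a : Fin J → Fin m → Fin n → ℝ) (w : Fin J → Fin m → ℝ) (j : Fin J) (i : Fin n) : ℝ :=
  ∑ r, a j r i * (meanObs s S x a j r + w j r) - m * s * ((if i ∈ S then 1 else 0) * x j i)

/-- The vector of signs on `D` determined by `P`. -/
def signVec {n J : ℕ} (D : Finset (Fin n)) (P : Finset (Fin J × Fin n)) (j : Fin J) (i : Fin n) :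
    ℝ :=
  if i ∈ D then if (j, i) ∈ P then 1 else -1 else 0

theorem sum_signVec_sq {n J : ℕ} (D : Finset (Fin n)) (P : Finset (Fin J × Fin n)) (j : Fin J) :
    ∑ i, signVec D P j i ^ 2 = D.card := by
  have h : ∀ i, signVec D P j i ^ 2 = if i ∈ D then 1 else 0 := by
    intro i; unfold signVec; split_ifs <;> norm_num
  simp_rw [h]
  simp

theorem crossCorr_eq {n m J : ℕ} (s : ℝ) (S : Finset (Fin n)) (v x : Fin J → Fin n → ℝ)
    (a : Fin J → Fin m → Fin n → ℝ) (w : Fin J → Fin m → ℝ) :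
    crossCorr s S v x a w = ∑ j, ∑ i, v j i * corrDev s S x a w j i := by
  rw [crossCorr]
  refine sum_congr rfl fun j _ => ?_
  simp only [corrDev, mul_sub, sum_sub_distrib, mul_sum, sum_mul, sum_const, card_univ,
    Fintype.card_fin, nsmul_eq_mul]
  congr 1
  · rw [sum_comm]
    exact sum_congr rfl fun i _ => sum_congr rfl fun r _ => by ring
  · exact sum_congr rfl fun i _ => by ring

theorem exists_signVec_crossCorr_ge {n m J : ℕ} (s : ℝ) (S : Finset (Fin n))
    (x : Fin J → Fin n → ℝ) (a : Fin J → Fin m → Fin n → ℝ) (w : Fin J → Fin m → ℝ) {b : ℝ}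
    {D : Finset (Fin n)} (h : ∀ i ∈ D, b ≤ ∑ j, |corrDev s S x a w j i|) :
    ∃ P ∈ (univ ×ˢ D).powerset, D.card * b ≤ crossCorr s S (signVec D P) x a w := by
  refine ⟨(univ ×ˢ D).filter fun q => 0 ≤ corrDev s S x a w q.1 q.2,
    mem_powerset.2 (filter_subset _ _), ?_⟩
  rw [crossCorr_eq, sum_comm, ← nsmul_eq_mul]
  calc D.card • b ≤ ∑ i ∈ D, ∑ j, |corrDev s S x a w j i| := card_nsmul_le_sum _ _ _ h
    _ = ∑ i, if i ∈ D then ∑ j, |corrDev s S x a w j i| else 0 := by simp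
    _ = _ := by
      refine sum_congr rfl fun i _ => ?_
      by_cases hi : i ∈ D
      · rw [if_pos hi]
        refine sum_congr rfl fun j _ => ?_
        by_cases hj : 0 ≤ corrDev s S x a w j i
        · simp [signVec, hi, hj, abs_of_nonneg hj]
        · simp [signVec, hi, hj, abs_of_neg (not_le.1 hj)]
      · simp [signVec, hi]

theorem exists_subset_of_lt_distor {n m J k d : ℕ} {s δ α : ℝ} (hk : 0 < k)
    (hms : 0 < m * s) (hd : ∀ c : ℕ, α * k < 2 * c → d ≤ c) (S : Finset (Fin n))
    (x : Fin J → Fin n → ℝ) (a : Fin J → Fin m → Fin n → ℝ) (w : Fin J → Fin m → ℝ)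
    (h : α < distor k S (corrEstimator n m J (δ * (J * (m * s)))
      (fun j r => meanObs s S x a j r + w j r) a)) :
    ∃ D ∈ powersetCard d univ,
      (∀ i ∈ D, δ * (J * (m * s)) ≤ ∑ j, |corrDev s S x a w j i|) ∨
      ∀ i ∈ D, ∑ j, |x j i| ≤ 2 * δ * J := by
  set T := corrEstimator n m J (δ * (J * (m * s))) (fun j r => meanObs s S x a j r + w j r) a
    with hT
  set B := univ.filter fun i => δ * (J * (m * s)) ≤ ∑ j, |corrDev s S x a w j i| with hB
  set E := univ.filter fun i : Fin n => ∑ j, |x j i| ≤ 2 * δ * J with hE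
  have hTmem : ∀ i, i ∈ T ↔ δ * (J * (m * s)) <
      ∑ j, |m * s * ((if i ∈ S then 1 else 0) * x j i) + corrDev s S x a w j i| := by
    intro i
    simp [hT, corrEstimator, corrDev]
  have h1 : T \ S ⊆ B ∪ E := by
    intro i hi
    rw [Finset.mem_sdiff, hTmem] at hi
    refine mem_union_left _ ?_
    simpa [hB, hi.2] using hi.1.le
  have h2 : S \ T ⊆ B ∪ E := by
    intro i hi
    rw [Finset.mem_sdiff, hTmem, not_lt] at hi
    by_cases hiB : i ∈ B
    · exact mem_union_left _ hiB
    refine mem_union_right _ ?_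
    rw [hB, mem_filter_univ, not_le] at hiB
    rw [hE, mem_filter_univ]
    simp only [hi.1, if_true, one_mul] at hi
    have h3 : m * s * ∑ j, |x j i| ≤ ∑ j, |m * s * x j i + corrDev s S x a w j i| +
        ∑ j, |corrDev s S x a w j i| := by
      rw [mul_sum, ← sum_add_distrib]
      refine sum_le_sum fun j _ => ?_
      rw [← abs_of_pos hms, ← abs_mul, abs_of_pos hms]
      simpa using abs_sub (m * s * x j i + corrDev s S x a w j i) (corrDev s S x a w j i)
    refine le_of_mul_le_mul_left ?_ hms
    linarith [hi.2]
  have h3 : α * k < (B ∪ E).card := by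
    rw [distor, lt_div_iff₀ (by exact_mod_cast hk)] at h
    refine h.trans_le (max_le ?_ ?_)
    · exact_mod_cast card_le_card h2
    · exact_mod_cast card_le_card h1
  have h4 : ((B ∪ E).card : ℝ) ≤ B.card + E.card := by exact_mod_cast card_union_le B E
  rcases le_total B.card E.card with hc | hc
  · have hc' : (B.card : ℝ) ≤ E.card := by exact_mod_cast hc
    obtain ⟨D, hD, hDc⟩ := exists_subset_card_eq (hd E.card (by linarith))
    exact ⟨D, mem_powersetCard.2 ⟨subset_univ _, hDc⟩,
      Or.inr fun i hi => (mem_filter.1 (hD hi)).2⟩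
  · have hc' : (E.card : ℝ) ≤ B.card := by exact_mod_cast hc
    obtain ⟨D, hD, hDc⟩ := exists_subset_card_eq (hd B.card (by linarith))
    exact ⟨D, mem_powersetCard.2 ⟨subset_univ _, hDc⟩,
      Or.inl fun i hi => (mem_filter.1 (hD hi)).2⟩

theorem one_le_smallWeight {J n : ℕ} {δ : ℝ} (hδ : 0 < δ) {D : Finset (Fin n)}
    {x : Fin J → Fin n → ℝ} (h : ∀ i ∈ D, ∑ j, |x j i| ≤ 2 * δ * J) : 1 ≤ smallWeight δ D x := by
  rw [smallWeight, one_le_exp_iff, sum_comm]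
  refine sum_nonneg fun i hi => ?_
  rw [sum_sub_distrib, ← sum_div, sub_nonneg, div_le_iff₀ (by positivity)]
  simpa [mul_comm] using h i hi

theorem one_le_energyWeight {J n : ℕ} {S : Finset (Fin n)} {j : Fin J} {x : Fin J → Fin n → ℝ}
    (h : 4 * S.card ≤ ∑ i ∈ S, x j i ^ 2) : 1 ≤ energyWeight S j x := by
  rw [energyWeight, one_le_exp_iff, sum_sub_distrib, ← mul_sum]
  simp only [sum_const, nsmul_eq_mul, mul_one]
  linarith

theorem measure_le_lintegral_of_one_le {Ω : Type*} [MeasurableSpace Ω] {μ : Measure Ω} {E : Set Ω}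
    {F : Ω → ℝ≥0∞} (hF : Measurable F) (h : ∀ ω ∈ E, 1 ≤ F ω) : μ E ≤ ∫⁻ ω, F ω ∂μ := by
  have h1 := mul_meas_ge_le_lintegral (μ := μ) hF 1
  rw [one_mul] at h1
  exact (measure_mono h).trans h1

/-- Signals of bounded energy on the pattern `S`. -/
def boundedEnergy {J n : ℕ} (S : Finset (Fin n)) : Set (Fin J → Fin n → ℝ) :=
  {x | ∀ j, ∑ i ∈ S, x j i ^ 2 ≤ 4 * (S.card : ℝ)}

theorem measurableSet_boundedEnergy {J n : ℕ} (S : Finset (Fin n)) :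
    MeasurableSet (boundedEnergy (J := J) S) := by
  unfold boundedEnergy
  simp only [Set.ofPred_forall]
  exact MeasurableSet.iInter fun j => measurableSet_le (by fun_prop) (by fun_prop)

/-- Chernoff weight of the event that the cross correlation is large. -/
def crossWeight {n m J : ℕ} (s τ b : ℝ) (S D : Finset (Fin n)) (P : Finset (Fin J × Fin n))
    (ω : Omega n m J) : ℝ≥0∞ :=
  (boundedEnergy S).indicator 1 ω.1 * (ENNReal.ofReal (exp (-(τ * b))) *
    ENNReal.ofReal (exp (τ * crossCorr s S (signVec D P) ω.1 ω.2.1 ω.2.2)))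

theorem measurable_crossWeight {n m J : ℕ} (s τ b : ℝ) (S D : Finset (Fin n))
    (P : Finset (Fin J × Fin n)) : Measurable (crossWeight (m := m) s τ b S D P) := by
  have h : Measurable ((boundedEnergy (J := J) S).indicator (1 : (Fin J → Fin n → ℝ) → ℝ≥0∞)) :=
    measurable_one.indicator (measurableSet_boundedEnergy S)
  unfold crossWeight crossCorr meanObs
  fun_prop

theorem one_le_crossWeight {n m J : ℕ} {s τ b : ℝ} {S D : Finset (Fin n)}
    {P : Finset (Fin J × Fin n)} {ω : Omega n m J} (hτ : 0 ≤ τ) (hω : ω.1 ∈ boundedEnergy S)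
    (h : b ≤ crossCorr s S (signVec D P) ω.1 ω.2.1 ω.2.2) : 1 ≤ crossWeight s τ b S D P ω := by
  rw [crossWeight, Set.indicator_of_mem hω, Pi.one_apply, one_mul,
    ← ENNReal.ofReal_mul (exp_pos _).le, ← exp_add, ENNReal.one_le_ofReal, one_le_exp_iff]
  nlinarith [mul_le_mul_of_nonneg_left h hτ]

theorem sum_add_signVec_sq_le {n J : ℕ} {S D : Finset (Fin n)} {P : Finset (Fin J × Fin n)}
    {x : Fin J → Fin n → ℝ} (hx : x ∈ boundedEnergy S) {q : ℝ} (hq : q ^ 2 ≤ 1 / 4)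
    (hD : D.card ≤ S.card) (j : Fin J) :
    ∑ i, ((if i ∈ S then 1 else 0) * x j i + q * signVec D P j i) ^ 2 ≤ 9 * (S.card : ℝ) := by
  have h1 : ∀ i, ((if i ∈ S then 1 else 0) * x j i + q * signVec D P j i) ^ 2 ≤
      2 * (if i ∈ S then x j i ^ 2 else 0) + 2 * q ^ 2 * signVec D P j i ^ 2 := by
    intro i
    split_ifs
    · nlinarith [sq_nonneg (x j i - q * signVec D P j i)]
    · nlinarith [sq_nonneg (q * signVec D P j i)]
  refine (sum_le_sum fun i _ => h1 i).trans ?_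
  rw [sum_add_distrib, ← mul_sum, ← mul_sum, sum_signVec_sq, sum_ite_mem, univ_inter]
  have h2 := hx j
  have h3 : (D.card : ℝ) ≤ S.card := by exact_mod_cast hD
  have h4 : (0 : ℝ) ≤ D.card := Nat.cast_nonneg _
  nlinarith

theorem lintegral_crossWeight_le {n m J : ℕ} {s τ b : ℝ} {S D : Finset (Fin n)}
    (P : Finset (Fin J × Fin n)) (hs : 0 < s) (hτ : 0 < τ) (hτs : τ ≤ s) (hD : 0 < D.card)
    (hDS : D.card ≤ S.card) (hk : τ * s * S.card ≤ 1 / 24) :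
    ∫⁻ ω, crossWeight s τ b S D P ω ∂omegaLaw n m J ≤ ENNReal.ofReal (exp
      (J * m * D.card * τ ^ 2 * (144 * (s ^ 2 * S.card) + 1 / 2) - τ * b)) := by
  have hd : (0 : ℝ) < D.card := by exact_mod_cast hD
  have hdk : (D.card : ℝ) ≤ S.card := by exact_mod_cast hDS
  have hk0 : (0 : ℝ) < S.card := hd.trans_le hdk
  set d : ℝ := (D.card : ℝ)
  set k : ℝ := (S.card : ℝ)
  have hr : √(k * d) ^ 2 = k * d := Real.sq_sqrt (by positivity)
  have hr0 : 0 < √(k * d) := Real.sqrt_pos.2 (by positivity)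
  have hrk : √(k * d) ≤ k := by
    refine Real.sqrt_le_iff.2 ⟨hk0.le, ?_⟩
    nlinarith
  set T := 3 * √(k * d) with hT
  have hq : (τ / (2 * s)) ^ 2 ≤ 1 / 4 := by
    rw [div_pow, div_le_iff₀ (by positivity)]
    nlinarith
  have hinner : ∀ x : Fin J → Fin n → ℝ, ∫⁻ z, crossWeight s τ b S D P (x, z)
      ∂(matrixLaw J m n).prod (noiseLaw J m) ≤ ENNReal.ofReal (exp
      (J * m * d * τ ^ 2 * (144 * (s ^ 2 * k) + 1 / 2) - τ * b)) := by
    intro x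
    by_cases hx : x ∈ boundedEnergy S
    · have hm : Measurable fun z : (Fin J → Fin m → Fin n → ℝ) × (Fin J → Fin m → ℝ) =>
          ENNReal.ofReal (exp (τ * crossCorr s S (signVec D P) x z.1 z.2)) := by
        unfold crossCorr meanObs; fun_prop
      simp only [crossWeight, Set.indicator_of_mem hx, Pi.one_apply, one_mul]
      rw [lintegral_const_mul _ hm]
      have h1 := lintegral_exp_crossCorr_le (m := m) (T := T) (t := T / d) hs hτ (by positivity) S
        (v := signVec D P) (x := x) (fun j => sum_signVec_sq D P j)
        (div_mul_cancel₀ T hd.ne').le (fun j => by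
          refine (sum_add_signVec_sq_le hx hq hDS j).trans_eq ?_
          rw [← mul_div_assoc, eq_div_iff hd.ne']
          change 9 * k * d = T * T
          rw [hT]
          linarith) (by
          have := mul_le_mul_of_nonneg_left hrk (mul_pos hτ hs).le
          rw [hT]
          linarith)
      refine (mul_le_mul_right h1 _).trans_eq ?_
      rw [← ENNReal.ofReal_mul (exp_pos _).le, ← exp_add]
      congr 2
      rw [hT, mul_pow, mul_pow _ (√(k * d)), hr]
      ring
    · simp [crossWeight, hx]
  rw [omegaLaw_eq, lintegral_prod _ (measurable_crossWeight s τ b S D P).aemeasurable]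
  refine (lintegral_mono hinner).trans_eq ?_
  rw [lintegral_const, measure_univ, mul_one]

theorem lintegral_omegaLaw_signal {n m J : ℕ} {f : (Fin J → Fin n → ℝ) → ℝ≥0∞}
    (hf : Measurable f) :
    ∫⁻ ω, f ω.1 ∂omegaLaw n m J = ∫⁻ x, f x ∂signalLaw J n := by
  rw [omegaLaw_eq]
  exact (measurePreserving_fst (μ := signalLaw J n)
    (ν := (matrixLaw J m n).prod (noiseLaw J m))).lintegral_comp hf

theorem measure_lt_distor_le {n m J k d : ℕ} {s τ δ α : ℝ} {S : Finset (Fin n)}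
    (hS : S.card = k) (hm : 0 < m) (hs : 0 < s) (hτ : 0 < τ) (hτs : τ ≤ s) (hδ : 0 < δ)
    (hk : τ * s * k ≤ 1 / 24) (hd : 0 < d) (hdk : d ≤ k) (hdα : ∀ c : ℕ, α * k < 2 * c → d ≤ c) :
    omegaLaw n m J {ω | α < distor k S (corrEstimator n m J (δ * (J * (m * s)))
      (fun j r => meanObs s S ω.1 ω.2.1 j r + ω.2.2 j r) ω.2.1)} ≤
      n.choose d * (2 ^ (J * d) * ENNReal.ofReal (exp (J * m * d * τ ^ 2 *
        (144 * (s ^ 2 * k) + 1 / 2) - τ * (d * (δ * (J * (m * s)))))) +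
        ENNReal.ofReal (exp 1 * (8 * δ)) ^ (J * d)) +
      J * ENNReal.ofReal (exp (-(k / 2))) := by
  set b : ℝ := d * (δ * (J * (m * s))) with hb
  set F : Omega n m J → ℝ≥0∞ := fun ω =>
    ∑ D ∈ powersetCard d univ, (∑ P ∈ ((univ : Finset (Fin J)) ×ˢ D).powerset,
      crossWeight s τ b S D P ω + ENNReal.ofReal (smallWeight δ D ω.1)) +
      ∑ j, ENNReal.ofReal (energyWeight S j ω.1) with hF
  have hms : 0 < (m : ℝ) * s := by
    have : (0 : ℝ) < m := by exact_mod_cast hm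
    positivity
  have hsw : ∀ D : Finset (Fin n), Measurable fun x : Fin J → Fin n → ℝ =>
      ENNReal.ofReal (smallWeight δ D x) := by
    intro D; unfold smallWeight; fun_prop
  have hew : ∀ j : Fin J, Measurable fun x : Fin J → Fin n → ℝ =>
      ENNReal.ofReal (energyWeight S j x) := by
    intro j; unfold energyWeight; fun_prop
  have hcw : ∀ (D : Finset (Fin n)) P, Measurable (crossWeight (m := m) (J := J) s τ b S D P) :=
    fun D P => measurable_crossWeight s τ b S D P
  have hsw' : ∀ D : Finset (Fin n), Measurable fun ω : Omega n m J =>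
      ENNReal.ofReal (smallWeight δ D ω.1) := fun D => (hsw D).comp measurable_fst
  have hew' : ∀ j : Fin J, Measurable fun ω : Omega n m J =>
      ENNReal.ofReal (energyWeight S j ω.1) := fun j => (hew j).comp measurable_fst
  have hin : ∀ D : Finset (Fin n), Measurable fun ω : Omega n m J =>
      ∑ P ∈ ((univ : Finset (Fin J)) ×ˢ D).powerset, crossWeight s τ b S D P ω :=
    fun D => Finset.measurable_sum _ fun P _ => hcw D P
  have hout : Measurable fun ω : Omega n m J => ∑ j, ENNReal.ofReal (energyWeight S j ω.1) :=
    Finset.measurable_sum _ fun j _ => hew' j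
  have hadd : ∀ D : Finset (Fin n), Measurable fun ω : Omega n m J =>
      ∑ P ∈ ((univ : Finset (Fin J)) ×ˢ D).powerset, crossWeight s τ b S D P ω +
        ENNReal.ofReal (smallWeight δ D ω.1) := fun D => (hin D).add (hsw' D)
  have hFm : Measurable F := (Finset.measurable_sum _ fun D _ => hadd D).add hout
  refine (measure_le_lintegral_of_one_le hFm fun ω hω => ?_).trans ?_
  · by_cases hx : ω.1 ∈ boundedEnergy S
    · obtain ⟨D, hD, h⟩ := exists_subset_of_lt_distor (hd.trans_le hdk) hms hdα S ω.1 ω.2.1 ω.2.2 hω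
      refine le_trans ?_ (le_add_right (single_le_sum (fun _ _ => zero_le) hD))
      rcases h with h | h
      · obtain ⟨P, hP, hc⟩ := exists_signVec_crossCorr_ge s S ω.1 ω.2.1 ω.2.2 h
        rw [(mem_powersetCard.1 hD).2] at hc
        exact (one_le_crossWeight hτ.le hx hc).trans (le_add_right
          (single_le_sum (f := fun P => crossWeight s τ b S D P ω) (fun _ _ => zero_le) hP))
      · exact le_add_left (ENNReal.one_le_ofReal.2 (one_le_smallWeight hδ h))
    · have : ∃ j, 4 * (S.card : ℝ) < ∑ i ∈ S, ω.1 j i ^ 2 := by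
        simpa [boundedEnergy] using hx
      obtain ⟨j, hj⟩ := this
      exact le_add_left ((ENNReal.one_le_ofReal.2 (one_le_energyWeight hj.le)).trans
        (single_le_sum (f := fun j => ENNReal.ofReal (energyWeight S j ω.1))
          (fun _ _ => zero_le) (mem_univ j)))
  · rw [hF, lintegral_add_right _ hout, lintegral_finsetSum _ fun D _ => hadd D,
      lintegral_finsetSum _ fun j _ => hew' j]
    refine add_le_add ?_ ?_
    · refine (sum_le_card_nsmul _ _ (2 ^ (J * d) * ENNReal.ofReal (exp (J * m * d * τ ^ 2 *
        (144 * (s ^ 2 * k) + 1 / 2) - τ * b)) +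
        ENNReal.ofReal (exp 1 * (8 * δ)) ^ (J * d)) fun D hD => ?_).trans_eq ?_
      · have hDc := (mem_powersetCard.1 hD).2
        rw [lintegral_add_right _ (hsw' D), lintegral_finsetSum _ fun P _ => hcw D P,
          lintegral_omegaLaw_signal (hsw D)]
        refine add_le_add ?_ (hDc ▸ lintegral_smallWeight_le hδ D)
        refine (sum_le_card_nsmul _ _ _ fun P _ => lintegral_crossWeight_le P hs hτ hτs
          (hDc.symm ▸ hd) (hDc.symm ▸ hS.symm ▸ hdk) (hS.symm ▸ hk)).trans_eq ?_
        rw [card_powerset, card_product, card_univ, Fintype.card_fin, hDc, hS, nsmul_eq_mul]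
        norm_num
      · rw [card_powersetCard, card_univ, Fintype.card_fin, nsmul_eq_mul]
    · refine (sum_le_card_nsmul _ _ (ENNReal.ofReal (exp (-(k / 2)))) fun j _ => ?_).trans_eq ?_
      · rw [lintegral_omegaLaw_signal (hew j), ← hS]
        exact lintegral_energyWeight_le S j
      · rw [card_univ, Fintype.card_fin, nsmul_eq_mul]

theorem chernoff_exponent_le {J m d k SNR s δ η : ℝ} (hJ : 0 ≤ J) (hd : 0 ≤ d) (hk : 0 < k)
    (hs : 0 < s) (hsk : s ^ 2 * k = SNR) (hm : 0 ≤ m) (hη : 0 < η)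
    (hηδ : η * (144 + 1 / (2 * SNR)) ≤ δ / 2) (hmk : 6 * k ≤ m * (η * δ)) :
    J * m * d * (η / (k * s)) ^ 2 * (144 * (s ^ 2 * k) + 1 / 2) -
      η / (k * s) * (d * (δ * (J * (m * s)))) ≤ -(3 * (J * d)) := by
  have h1 : J * m * d * (η / (k * s)) ^ 2 * (144 * (s ^ 2 * k) + 1 / 2) -
      η / (k * s) * (d * (δ * (J * (m * s)))) =
      J * d * (m * η / k) * (η * (144 + 1 / (2 * SNR)) - δ) := by
    rw [← hsk]
    field_simp
  have h2 : m * η / k * (η * (144 + 1 / (2 * SNR)) - δ) ≤ -3 := by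
    calc _ ≤ m * η / k * (-(δ / 2)) := by
          refine mul_le_mul_of_nonneg_left (by linarith) (by positivity)
      _ ≤ -3 := by
          rw [div_mul_eq_mul_div, div_le_iff₀ hk]
          linarith
  rw [h1, mul_assoc]
  have := mul_le_mul_of_nonneg_left h2 (mul_nonneg hJ hd)
  linarith

theorem measure_lt_distor_toReal_le {n m J k d : ℕ} {SNR η α : ℝ} {S : Finset (Fin n)}
    (hS : S.card = k) (hSNR : 0 < SNR) (hη : 0 < η) (hη' : η ≤ 1 / 24) (hηS : η ≤ SNR)
    (hηδ : η * (144 + 1 / (2 * SNR)) ≤ exp (-6) / 2)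
    (hmk : 6 * k ≤ m * (η * exp (-6))) (hd : 0 < d) (hdk : d ≤ k)
    (hdα : ∀ c : ℕ, α * k < 2 * c → d ≤ c) :
    (omegaLaw n m J {ω | α < distor k S (corrEstimator n m J (exp (-6) * (J * (m * √(SNR / k))))
      (Yobs n m J SNR k S ω) ω.2.1)}).toReal ≤
      2 * (n.choose d * exp (-2) ^ (J * d)) + J * exp (-(k / 2)) := by
  have hk : (0 : ℝ) < k := by exact_mod_cast hd.trans_le hdk
  have hm : 0 < m := by
    rw [Nat.pos_iff_ne_zero]; rintro rfl; simp at hmk; linarith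
  have hs : 0 < √(SNR / k) := Real.sqrt_pos.2 (by positivity)
  have hs2 : √(SNR / k) ^ 2 * k = SNR := by
    rw [Real.sq_sqrt (by positivity), div_mul_cancel₀ _ hk.ne']
  simp_rw [Yobs_eq]
  set s := √(SNR / k)
  refine ENNReal.toReal_le_of_le_ofReal (by positivity) ?_
  refine (measure_lt_distor_le hS hm hs (τ := η / (k * s)) (by positivity) ?_ (exp_pos _) ?_ hd hdk
    hdα).trans ?_
  · rw [div_le_iff₀ (by positivity)]
    linarith
  · rw [div_mul_eq_mul_div, div_mul_eq_mul_div, div_le_iff₀ (by positivity)]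
    have : 0 < k * s := by positivity
    nlinarith
  have h1 := chernoff_exponent_le (Nat.cast_nonneg J) (Nat.cast_nonneg d) hk hs hs2
    (Nat.cast_nonneg m) hη hηδ hmk
  have h8 : (8 : ℝ) ≤ exp 3 := by
    have := exp_one_gt_d9
    calc (8 : ℝ) = 2 ^ 3 := by norm_num
      _ ≤ exp 1 ^ 3 := by gcongr; linarith
      _ = exp 3 := by rw [← exp_nat_mul]; norm_num
  have h2 : exp 1 * (8 * exp (-6)) ≤ exp (-2) := by
    calc exp 1 * (8 * exp (-6)) ≤ exp 1 * (exp 3 * exp (-6)) := by gcongr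
      _ = exp (-2) := by rw [← exp_add, ← exp_add]; norm_num
  have h3 : (2 : ℝ) ^ (J * d) * exp (-(3 * (J * d))) ≤ exp (-2) ^ (J * d) := by
    have h4 : (2 : ℝ) ≤ exp 1 := by linarith [exp_one_gt_d9]
    calc (2 : ℝ) ^ (J * d) * exp (-(3 * (J * d)))
        ≤ exp 1 ^ (J * d) * exp (-(3 * (J * d))) := by gcongr
      _ = exp (-2) ^ (J * d) := by
        rw [← exp_nat_mul, ← exp_nat_mul, ← exp_add]
        push_cast
        congr 1
        ring
  have e1 : (2 : ℝ≥0∞) ^ (J * d) = ENNReal.ofReal (2 ^ (J * d)) := by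
    rw [ENNReal.ofReal_pow (by norm_num)]; norm_num
  rw [e1, ← ENNReal.ofReal_mul (by positivity), ← ENNReal.ofReal_pow (by positivity),
    ← ENNReal.ofReal_add (by positivity) (by positivity), ← ENNReal.ofReal_natCast,
    ← ENNReal.ofReal_mul (by positivity), ← ENNReal.ofReal_natCast J,
    ← ENNReal.ofReal_mul (by positivity), ← ENNReal.ofReal_add (by positivity) (by positivity)]
  refine ENNReal.ofReal_le_ofReal (add_le_add_left ?_ _)
  rw [two_mul, ← mul_add]
  refine mul_le_mul_of_nonneg_left (add_le_add ?_
    (pow_le_pow_left₀ (by positivity) h2 _)) (by positivity)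
  exact (mul_le_mul_of_nonneg_left (exp_le_exp.2 h1) (by positivity)).trans h3

theorem errProb_le_of_forall {n m J k : ℕ} {SNR α B : ℝ} {est : Estimator n m J} (hkn : k ≤ n)
    (h : ∀ S ∈ patterns n k,
      (omegaLaw n m J {ω | α < distor k S (est (Yobs n m J SNR k S ω) ω.2.1)}).toReal ≤ B) :
    errProb n m J k SNR α est ≤ B := by
  have hc : (0 : ℝ) < n.choose k := by exact_mod_cast Nat.choose_pos hkn
  rw [errProb, inv_mul_le_iff₀ hc]
  refine (sum_le_card_nsmul _ _ _ h).trans_eq ?_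
  rw [patterns, card_powersetCard, card_univ, Fintype.card_fin, nsmul_eq_mul]

theorem choose_le_exp_mul_div_pow (n : ℕ) {d : ℕ} (hd : 0 < d) :
    (n.choose d : ℝ) ≤ (exp 1 * n / d) ^ d := by
  have hd' : (0 : ℝ) < d := by exact_mod_cast hd
  have h1 : (d : ℝ) ^ d / d.factorial ≤ exp d := Real.pow_div_factorial_le_exp _ hd'.le d
  have hf : (0 : ℝ) < d.factorial := by exact_mod_cast d.factorial_pos
  have h2 : (n.choose d : ℝ) ≤ n ^ d / d.factorial := Nat.choose_le_pow_div d n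
  refine h2.trans ?_
  rw [div_le_iff₀ hf] at h1
  rw [div_pow, mul_pow, ← exp_nat_mul, mul_one, div_le_div_iff₀ hf (by positivity)]
  nlinarith [pow_nonneg (Nat.cast_nonneg n : (0 : ℝ) ≤ n) d]

theorem choose_mul_pow_le {n J k d : ℕ} {κ α : ℝ} (hκ : 0 < κ) (hα : 0 < α)
    (hακ : α ≤ κ / (8 * exp 1)) (hd : 0 < d) (hdk : α * k ≤ 2 * d) (hk : κ * n ≤ 2 * k)
    (hJ : log (1 / α) ≤ J) :
    (n.choose d : ℝ) * exp (-2) ^ (J * d) ≤ (1 / 2) ^ d := by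
  have hd' : (0 : ℝ) < d := by exact_mod_cast hd
  have h1 : exp (-2) ^ J ≤ α ^ 2 := by
    rw [← exp_nat_mul, ← exp_log hα, ← exp_nat_mul]
    rw [one_div, log_inv] at hJ
    refine exp_le_exp.2 ?_
    push_cast
    linarith
  have h2 : exp 1 * n / d ≤ 4 * exp 1 / (κ * α) := by
    rw [div_le_div_iff₀ hd' (by positivity)]
    have : κ * α * n ≤ 4 * d := by nlinarith
    nlinarith [exp_pos 1]
  have h3 : 4 * exp 1 / (κ * α) * α ^ 2 ≤ 1 / 2 := by
    rw [le_div_iff₀ (by positivity)] at hακ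
    rw [div_mul_eq_mul_div, div_le_iff₀ (by positivity)]
    nlinarith
  calc (n.choose d : ℝ) * exp (-2) ^ (J * d)
      ≤ (exp 1 * n / d) ^ d * (exp (-2) ^ J) ^ d := by
        rw [pow_mul]; gcongr; exact choose_le_exp_mul_div_pow n hd
    _ ≤ (4 * exp 1 / (κ * α)) ^ d * (α ^ 2) ^ d := by gcongr
    _ = (4 * exp 1 / (κ * α) * α ^ 2) ^ d := (mul_pow _ _ _).symm
    _ ≤ (1 / 2) ^ d := by gcongr

theorem errProb_nonneg (n m J k : ℕ) (SNR α : ℝ) (est : Estimator n m J) :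
    0 ≤ errProb n m J k SNR α est :=
  mul_nonneg (by positivity) (sum_nonneg fun _ _ => ENNReal.toReal_nonneg)

theorem achievable_of_log_le {κ SNR η α : ℝ} {J R : ℕ} (hκ : κ ∈ Set.Ioo 0 (1 / 2))
    (hSNR : 0 < SNR) (hη : 0 < η) (hη' : η ≤ 1 / 24) (hηS : η ≤ SNR)
    (hηδ : η * (144 + 1 / (2 * SNR)) ≤ exp (-6) / 2) (hR : 6 ≤ R * (η * exp (-6)))
    (hα : 0 < α) (hα1 : α ≤ 1) (hακ : α ≤ κ / (8 * exp 1)) (hJ : log (1 / α) ≤ J) :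
    achievable κ SNR (J * R) J α := by
  have hκ0 := hκ.1
  have hκ1 := hκ.2
  have hkt : Tendsto (fun n : ℕ => ⌊κ * n⌋₊) atTop atTop :=
    tendsto_nat_floor_atTop.comp (tendsto_natCast_atTop_atTop.const_mul_atTop hκ0)
  have hkt' : Tendsto (fun n : ℕ => (⌊κ * n⌋₊ : ℝ)) atTop atTop :=
    tendsto_natCast_atTop_atTop.comp hkt
  have hdt : Tendsto (fun n : ℕ => ⌈α / 2 * ⌊κ * n⌋₊⌉₊) atTop atTop :=
    tendsto_nat_ceil_atTop.comp (hkt'.const_mul_atTop (by positivity))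
  refine ⟨fun n => ⌊κ * n⌋₊, fun n => R * n, fun n => corrEstimator n (R * n) J
    (exp (-6) * (J * ((R * n : ℕ) * √(SNR / ⌊κ * n⌋₊)))), ?_, ?_, ?_⟩
  · exact (tendsto_nat_floor_mul_div_atTop hκ0.le).comp tendsto_natCast_atTop_atTop
  · refine tendsto_const_nhds.congr' ?_
    filter_upwards [eventually_gt_atTop 0] with n hn
    have hn' : (0 : ℝ) < n := by exact_mod_cast hn
    push_cast
    field_simp
  · have hlim : Tendsto (fun n : ℕ => 2 * (1 / 2 : ℝ) ^ ⌈α / 2 * ⌊κ * n⌋₊⌉₊ +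
        J * exp (-((⌊κ * n⌋₊ : ℝ) / 2))) atTop (𝓝 0) := by
      have h1 := ((tendsto_pow_atTop_nhds_zero_of_lt_one (r := (1 / 2 : ℝ)) (by norm_num)
        (by norm_num)).comp hdt).const_mul 2
      have h2 := ((tendsto_exp_neg_atTop_nhds_zero.comp
        (hkt'.atTop_div_const (r := 2) (by norm_num))).const_mul (J : ℝ))
      simpa using h1.add h2
    refine tendsto_of_tendsto_of_tendsto_of_le_of_le' tendsto_const_nhds hlim
      (Eventually.of_forall fun n => errProb_nonneg _ _ _ _ _ _ _) ?_
    filter_upwards [hkt.eventually_ge_atTop 1] with n hk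
    set k := ⌊κ * n⌋₊ with hkdef
    have hn : (0 : ℝ) ≤ n := Nat.cast_nonneg n
    have hk1 : (1 : ℝ) ≤ k := by exact_mod_cast hk
    have hk2 : (k : ℝ) ≤ κ * n := Nat.floor_le (by positivity)
    have hk3 : κ * n < k + 1 := Nat.lt_floor_add_one _
    have hkn : (k : ℝ) ≤ n := by nlinarith
    have hd : 0 < ⌈α / 2 * k⌉₊ := Nat.ceil_pos.2 (by positivity)
    have hd1 : α / 2 * k ≤ ⌈α / 2 * k⌉₊ := Nat.le_ceil _
    refine errProb_le_of_forall (by exact_mod_cast hkn) fun S hS => ?_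
    refine (measure_lt_distor_toReal_le (mem_powersetCard.1 hS).2 hSNR hη hη' hηS hηδ ?_ hd ?_
      fun c hc => Nat.ceil_le.2 (by linarith)).trans ?_
    · push_cast
      nlinarith
    · exact Nat.ceil_le.2 (by nlinarith)
    · gcongr
      exact choose_mul_pow_le (k := k) hκ0 hα hακ hd (by linarith) (by linarith) hJ

/-- **Theorem 6, second part** (Optimal diversity gives exponential decay). For fixed `κ`
and `SNR` there are constants `0 < c ≤ C < ∞` and a choice of diversity
`J*(α) = Θ(log(1/α))` such that `ρ(α, J*(α)) = Θ(log(1/α))` for all small enough `α`. -/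
theorem optimal_diversity_exponential_decay
    (κ SNR : ℝ) (hκ : κ ∈ Set.Ioo 0 (1/2)) (hSNR : 0 < SNR) :
    ∃ c C : ℝ, 0 < c ∧ c ≤ C ∧
      ∃ Jstar : ℝ → ℕ, ∃ α₀ > (0:ℝ), ∀ α : ℝ, 0 < α → α < α₀ →
        (c * Real.log (1 / α) ≤ (Jstar α : ℝ) ∧
          (Jstar α : ℝ) ≤ C * Real.log (1 / α)) ∧
        (c * Real.log (1 / α) ≤ rhoStar κ SNR (Jstar α) α ∧
          rhoStar κ SNR (Jstar α) α ≤ C * Real.log (1 / α)) := by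
  have hκ0 := hκ.1
  set η : ℝ := min (1 / 24) (min SNR (exp (-6) / 2 / (144 + 1 / (2 * SNR)))) with hηdef
  have hη : 0 < η := lt_min (by norm_num) (lt_min hSNR (by positivity))
  have hη' : η ≤ 1 / 24 := min_le_left _ _
  have hηS : η ≤ SNR := (min_le_right _ _).trans (min_le_left _ _)
  have hηδ : η * (144 + 1 / (2 * SNR)) ≤ exp (-6) / 2 := by
    rw [← le_div_iff₀ (by positivity)]
    exact (min_le_right _ _).trans (min_le_right _ _)
  obtain ⟨R, hR⟩ := exists_nat_ge (6 / (η * exp (-6)))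
  rw [div_le_iff₀ (by positivity)] at hR
  refine ⟨min 1 (κ / (2 * SNR)), max 2 (2 * R), by positivity, (min_le_left _ _).trans
    (one_le_two.trans (le_max_left _ _)), fun α => ⌈log (1 / α)⌉₊,
    min (1 / 16) (κ / (8 * exp 1)), by positivity, fun α hα hα₀ => ?_⟩
  have hα16 : α ≤ 1 / 16 := hα₀.le.trans (min_le_left _ _)
  have hακ : α ≤ κ / (8 * exp 1) := hα₀.le.trans (min_le_right _ _)
  have hlog : 1 ≤ log (1 / α) := by
    rw [le_log_iff_exp_le (by positivity), le_div_iff₀ hα]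
    nlinarith [exp_one_lt_d9]
  have hJ : log (1 / α) ≤ ⌈log (1 / α)⌉₊ := Nat.le_ceil _
  have hJ2 : (⌈log (1 / α)⌉₊ : ℝ) ≤ 2 * log (1 / α) := by
    linarith [Nat.ceil_lt_add_one (zero_le_one.trans hlog)]
  have hach := achievable_of_log_le hκ hSNR hη hη' hηS hηδ hR hα (by linarith) hακ hJ
  have hlow : ∀ ρ ∈ {ρ | achievable κ SNR ρ ⌈log (1 / α)⌉₊ α},
      κ / (2 * SNR) * log (1 / α) ≤ ρ := fun ρ hρ => log_le_of_achievable hκ hSNR hα hα16 hρ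
  refine ⟨⟨?_, ?_⟩, ?_, ?_⟩
  · nlinarith [min_le_left 1 (κ / (2 * SNR))]
  · nlinarith [le_max_left 2 (2 * (R : ℝ))]
  · refine le_trans ?_ (le_csInf ⟨_, hach⟩ hlow)
    nlinarith [min_le_right 1 (κ / (2 * SNR))]
  · refine (csInf_le ⟨_, hlow⟩ hach).trans ?_
    nlinarith [le_max_right 2 (2 * (R : ℝ)), (Nat.cast_nonneg R : (0 : ℝ) ≤ R)]

end Sparsity
end
end

section
/- (Convergence of the diversity power.) Fix J ≥ 1 and β ∈ (0,1]. For each n, let S ⊂ {1,…,n} with |S| = k (where k/n → κ ∈ (0,1/2)), and let the nonzero values {X_j(i) : i ∈ S, j = 1,…,J} be i.i.d. N(0,1). Define the normalized minimum restricted power P_J^{(n)}(β) = min_{Δ ⊆ S, |Δ| = ⌊βk⌋} (1/(kJ))·Σ_{j=1}^J ‖X_j(Δ)‖². Then, as n → ∞, P_J^{(n)}(β) converges almost surely to the nonrandom limit P_J(β) = ∫_0^β ξ_J(p) dp. -/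
open MeasureTheory ProbabilityTheory Real Filter Finset Topology
open scoped ENNReal NNReal

noncomputable section

namespace Sparsity

/-- The normalized minimum restricted power
`P_J^{(n)}(β) = min_{Δ ⊆ S, |Δ| = a} (1/(kJ)) ∑_j ‖X_j(Δ)‖²`. -/
def minRestrictedPower (n J k a : ℕ) (S : Finset (Fin n)) (x : Fin J → Fin n → ℝ) : ℝ :=
  sInf {v : ℝ | ∃ Δ ∈ S.powersetCard a,
    v = (1 / ((k : ℝ) * J)) * ∑ j : Fin J, ∑ i ∈ Δ, (x j i) ^ 2}

lemma integrable_pow_of_memLp_four {Ω : Type*} [MeasurableSpace Ω] {μ : Measure Ω}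
    [IsFiniteMeasure μ] {X : Ω → ℝ} (hX : MemLp X 4 μ) {p : ℕ} (hp : p ≤ 4) :
    Integrable (fun ω => X ω ^ p) μ := by
  have h : MemLp X (p : ℝ≥0∞) μ := hX.mono_exponent (by exact_mod_cast hp)
  refine h.integrable_norm_pow'.mono' (hX.1.pow p) (ae_of_all _ fun ω => ?_)
  simp

lemma integral_pow_mul_pow_of_indepFun {Ω : Type*} [MeasurableSpace Ω] {μ : Measure Ω}
    [IsProbabilityMeasure μ] {X Y : Ω → ℝ} (hX : MemLp X 4 μ) (hY : MemLp Y 4 μ)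
    (h : IndepFun X Y μ) {p q : ℕ} (hp : p ≤ 4) (hq : q ≤ 4) :
    Integrable (fun ω => X ω ^ p * Y ω ^ q) μ ∧
      ∫ ω, X ω ^ p * Y ω ^ q ∂μ = (∫ ω, X ω ^ p ∂μ) * ∫ ω, Y ω ^ q ∂μ := by
  have hi : IndepFun (fun ω => X ω ^ p) (fun ω => Y ω ^ q) μ :=
    h.comp (measurable_id.pow_const p) (measurable_id.pow_const q)
  exact ⟨hi.integrable_mul (integrable_pow_of_memLp_four hX hp)
      (integrable_pow_of_memLp_four hY hq),
    hi.integral_fun_mul_eq_mul_integral (hX.1.pow p) (hY.1.pow q)⟩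

/-- Second and fourth moments of a sum of two independent centered variables. -/
lemma moments_add_of_indepFun {Ω : Type*} [MeasurableSpace Ω] {μ : Measure Ω}
    [IsProbabilityMeasure μ] {X Y : Ω → ℝ} (hX : MemLp X 4 μ) (hY : MemLp Y 4 μ)
    (h : IndepFun X Y μ) (hX0 : ∫ ω, X ω ∂μ = 0) (hY0 : ∫ ω, Y ω ∂μ = 0) :
    ∫ ω, (X ω + Y ω) ^ 2 ∂μ = ∫ ω, X ω ^ 2 ∂μ + ∫ ω, Y ω ^ 2 ∂μ ∧
    ∫ ω, (X ω + Y ω) ^ 4 ∂μ = ∫ ω, X ω ^ 4 ∂μ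
      + 6 * ((∫ ω, X ω ^ 2 ∂μ) * ∫ ω, Y ω ^ 2 ∂μ) + ∫ ω, Y ω ^ 4 ∂μ := by
  have iX {p : ℕ} (hp : p ≤ 4) := integrable_pow_of_memLp_four hX hp
  have iY {p : ℕ} (hp : p ≤ 4) := integrable_pow_of_memLp_four hY hp
  obtain ⟨i11, e11⟩ := integral_pow_mul_pow_of_indepFun hX hY h (p := 1) (q := 1)
    (by norm_num) (by norm_num)
  obtain ⟨i31, e31⟩ := integral_pow_mul_pow_of_indepFun hX hY h (p := 3) (q := 1)
    (by norm_num) (by norm_num)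
  obtain ⟨i22, e22⟩ := integral_pow_mul_pow_of_indepFun hX hY h (p := 2) (q := 2)
    (by norm_num) (by norm_num)
  obtain ⟨i13, e13⟩ := integral_pow_mul_pow_of_indepFun hX hY h (p := 1) (q := 3)
    (by norm_num) (by norm_num)
  simp only [pow_one, hX0, hY0, mul_zero, zero_mul] at i11 e11 i31 e31 i13 e13
  constructor
  · have : (fun ω => (X ω + Y ω) ^ 2) = fun ω => X ω ^ 2 + 2 * (X ω * Y ω) + Y ω ^ 2 := by
      ext ω; ring
    rw [this, integral_add ((iX (p := 2) (by norm_num)).fun_add (i11.const_mul 2)) (iY (by norm_num)),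
      integral_add (iX (by norm_num)) (i11.const_mul 2), integral_const_mul, e11]
    ring
  · have : (fun ω => (X ω + Y ω) ^ 4) = fun ω => X ω ^ 4 + 4 * (X ω ^ 3 * Y ω)
        + 6 * (X ω ^ 2 * Y ω ^ 2) + 4 * (X ω * Y ω ^ 3) + Y ω ^ 4 := by
      ext ω; ring
    have i1 := (iX (p := 4) le_rfl).fun_add (i31.const_mul 4)
    have i2 := i1.fun_add (i22.const_mul 6)
    have i3 := i2.fun_add (i13.const_mul 4)
    rw [this, integral_add i3 (iY le_rfl), integral_add i2 (i13.const_mul 4),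
      integral_add i1 (i22.const_mul 6), integral_add (iX le_rfl) (i31.const_mul 4)]
    simp only [integral_const_mul, e31, e22, e13]
    ring

/-- Fourth moment bound for sums of independent centered variables. -/
lemma integral_sum_pow_four_le {Ω ι : Type*} [MeasurableSpace Ω] {μ : Measure Ω}
    [IsProbabilityMeasure μ] {Z : ι → Ω → ℝ} (hZ : ∀ i, MemLp (Z i) 4 μ)
    (hind : iIndepFun Z μ) (h0 : ∀ i, ∫ ω, Z i ω ∂μ = 0) {v M : ℝ}
    (hv : ∀ i, ∫ ω, Z i ω ^ 2 ∂μ ≤ v) (hM : ∀ i, ∫ ω, Z i ω ^ 4 ∂μ ≤ M) (s : Finset ι) :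
    ∫ ω, (∑ i ∈ s, Z i ω) ^ 4 ∂μ ≤ s.card * M + 3 * (s.card * v) ^ 2 := by
  classical
  suffices H : ∫ ω, (∑ i ∈ s, Z i ω) ∂μ = 0 ∧ ∫ ω, (∑ i ∈ s, Z i ω) ^ 2 ∂μ ≤ s.card * v ∧
      ∫ ω, (∑ i ∈ s, Z i ω) ^ 4 ∂μ ≤ s.card * M + 3 * (s.card * v) ^ 2 from H.2.2
  induction s using Finset.induction_on with
  | empty => simp
  | insert a s ha ih =>
    obtain ⟨ih1, ih2, ih4⟩ := ih
    have hS : MemLp (fun ω => ∑ i ∈ s, Z i ω) 4 μ := memLp_finsetSum s fun i _ => hZ i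
    have hi : IndepFun (Z a) (fun ω => ∑ i ∈ s, Z i ω) μ := by
      have := hind.indepFun_finsetSum_of_notMem₀ (fun i => (hZ i).1.aemeasurable) ha
      convert this.symm using 1
      ext ω; simp
    obtain ⟨e2, e4⟩ := moments_add_of_indepFun (hZ a) hS hi (h0 a) ih1
    have hv0 : 0 ≤ ∫ ω, Z a ω ^ 2 ∂μ := integral_nonneg fun _ => sq_nonneg _
    have hs0 : 0 ≤ ∫ ω, (∑ i ∈ s, Z i ω) ^ 2 ∂μ := integral_nonneg fun _ => sq_nonneg _
    simp only [Finset.sum_insert ha, Finset.card_insert_of_notMem ha, Nat.cast_add, Nat.cast_one]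
    refine ⟨?_, ?_, ?_⟩
    · rw [integral_add ((hZ a).integrable (by norm_num)) (hS.integrable (by norm_num)), h0, ih1,
        add_zero]
    · rw [e2]; linarith [hv a]
    · rw [e4]
      have := mul_le_mul (hv a) ih2 hs0 (hv0.trans (hv a))
      nlinarith [hM a, sq_nonneg v]

lemma exists_integral_centered_sum_pow_four_le {α : Type*} [MeasurableSpace α] (μ : Measure α)
    [IsProbabilityMeasure μ] {f : α → ℝ} (hf : MemLp f 4 μ) :
    ∃ C : ℝ, ∀ (n : ℕ) (s : Finset (Fin n)),
      Integrable (fun y : Fin n → α => (∑ i ∈ s, (f (y i) - ∫ x, f x ∂μ)) ^ 4)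
        (Measure.pi fun _ => μ) ∧
      ∫ y : Fin n → α, (∑ i ∈ s, (f (y i) - ∫ x, f x ∂μ)) ^ 4 ∂(Measure.pi fun _ => μ)
        ≤ C * (s.card : ℝ) ^ 2 := by
  set h : α → ℝ := fun x => f x - ∫ x, f x ∂μ with hh
  have hh4 : MemLp h 4 μ := hf.sub (memLp_const _)
  have hh0 : ∫ x, h x ∂μ = 0 := by
    simp [hh, integral_sub (hf.integrable (by norm_num)) (integrable_const _)]
  have hM0 : 0 ≤ ∫ x, h x ^ 4 ∂μ := integral_nonneg fun x => by positivity
  refine ⟨∫ x, h x ^ 4 ∂μ + 3 * (∫ x, h x ^ 2 ∂μ) ^ 2, fun n s => ?_⟩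
  have mp (i : Fin n) := measurePreserving_eval (fun _ : Fin n => μ) i
  have hZ (i : Fin n) : MemLp (fun y : Fin n → α => h (y i)) 4 (Measure.pi fun _ => μ) :=
    hh4.comp_measurePreserving (mp i)
  have hint {g : α → ℝ} (hg : AEStronglyMeasurable g μ) (i : Fin n) :
      ∫ y : Fin n → α, g (y i) ∂(Measure.pi fun _ => μ) = ∫ x, g x ∂μ := by
    rw [← (mp i).map_eq] at hg
    rw [← integral_map (mp i).aemeasurable hg, (mp i).map_eq]
  have key := integral_sum_pow_four_le hZ (iIndepFun_pi fun _ => hh4.1.aemeasurable)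
    (fun i => (hint hh4.1 i).trans hh0) (fun i => (hint (hh4.1.pow 2) i).le)
    (fun i => (hint (hh4.1.pow 4) i).le) s
  refine ⟨integrable_pow_of_memLp_four (memLp_finsetSum s fun i _ => hZ i) le_rfl,
    key.trans ?_⟩
  simp only [Pi.pow_apply]
  have hs : (s.card : ℝ) ≤ (s.card : ℝ) ^ 2 := by
    exact_mod_cast Nat.le_self_pow two_ne_zero _
  nlinarith [mul_le_mul_of_nonneg_right hs hM0]

/-- A sequence of nonnegative random variables with summable expectations tends to zero almost
surely. -/
lemma ae_tendsto_zero_of_lintegral_le {Ω : Type*} [MeasurableSpace Ω] {P : Measure Ω}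
    {X : ℕ → Ω → ℝ≥0∞} (hX : ∀ n, AEMeasurable (X n) P) {b : ℕ → ℝ} (hb : Summable b)
    (hb0 : ∀ n, 0 ≤ b n) (hle : ∀ n, ∫⁻ ω, X n ω ∂P ≤ ENNReal.ofReal (b n)) :
    ∀ᵐ ω ∂P, Tendsto (fun n => X n ω) atTop (𝓝 0) := by
  have hfin : ∫⁻ ω, ∑' n, X n ω ∂P ≠ ∞ := by
    rw [lintegral_tsum hX]
    refine ne_top_of_le_ne_top ?_ (ENNReal.tsum_le_tsum hle)
    rw [← ENNReal.ofReal_tsum_of_nonneg hb0 hb]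
    exact ENNReal.ofReal_ne_top
  filter_upwards [ae_lt_top' (AEMeasurable.tsum hX) hfin] with ω hω
  exact ENNReal.tendsto_atTop_zero_of_tsum_ne_top hω.ne

lemma tendsto_zero_of_pow_four {x : ℕ → ℝ} (h : Tendsto (fun n => x n ^ 4) atTop (𝓝 0)) :
    Tendsto x atTop (𝓝 0) := by
  rw [tendsto_zero_iff_abs_tendsto_zero]
  have h2 := h.sqrt.sqrt
  rw [Real.sqrt_zero, Real.sqrt_zero] at h2
  refine h2.congr fun n => ?_
  rw [show x n ^ 4 = (x n ^ 2) ^ 2 by ring, Real.sqrt_sq (sq_nonneg _), Real.sqrt_sq_eq_abs]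
  rfl

/-- Strong law of large numbers for the rows of a triangular array, with no assumption on the
joint law of different rows. -/
theorem ae_tendsto_average {α Ω : Type*} [MeasurableSpace α] [MeasurableSpace Ω]
    (μ : Measure α) [IsProbabilityMeasure μ] (P : Measure Ω) [IsProbabilityMeasure P]
    {κ : ℝ} (hκ : 0 < κ) {k : ℕ → ℕ} (hk : Tendsto (fun n => (k n : ℝ) / n) atTop (𝓝 κ))
    {S : ∀ n, Finset (Fin n)} (hS : ∀ n, (S n).card = k n)
    {Y : ∀ n, Ω → Fin n → α} (hYm : ∀ n, AEMeasurable (Y n) P)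
    (hY : ∀ n, P.map (Y n) = Measure.pi fun _ => μ)
    {f : α → ℝ} (hfm : Measurable f) (hf : MemLp f 4 μ) :
    ∀ᵐ ω ∂P, Tendsto (fun n => (∑ i ∈ S n, f (Y n ω i)) / k n) atTop (𝓝 (∫ x, f x ∂μ)) := by
  set m := ∫ x, f x ∂μ with hm
  obtain ⟨C, hC⟩ := exists_integral_centered_sum_pow_four_le μ hf
  have hC0 : 0 ≤ C := by
    obtain ⟨-, h⟩ := hC 1 Finset.univ
    have : 0 ≤ C * ((Finset.univ : Finset (Fin 1)).card : ℝ) ^ 2 :=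
      (integral_nonneg fun y => by positivity).trans h
    simpa using this
  have hmeas (n : ℕ) : Measurable fun y : Fin n → α => (∑ i ∈ S n, (f (y i) - m)) / k n := by
    fun_prop
  have hsum : Summable fun n => C * (k n : ℝ) ^ 2 / (k n : ℝ) ^ 4 := by
    have hev : ∀ᶠ n in atTop, κ / 2 < (k n : ℝ) / n := hk.eventually_const_lt (by linarith)
    refine summable_of_isBigO_nat (Real.summable_one_div_nat_pow.2 one_lt_two)
      (Asymptotics.IsBigO.of_bound (C * (2 / κ) ^ 2) ?_)
    filter_upwards [hev, eventually_gt_atTop 0] with n hn hn0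
    have hn0' : (0 : ℝ) < n := by exact_mod_cast hn0
    rw [lt_div_iff₀ hn0'] at hn
    have hkpos : (0 : ℝ) < k n := lt_trans (by positivity) hn
    have h1 : C * (k n : ℝ) ^ 2 / (k n : ℝ) ^ 4 = C * (1 / (k n : ℝ)) ^ 2 := by
      field_simp
    have h2 : 1 / (k n : ℝ) ≤ 2 / κ * (1 / n) := by
      rw [div_mul_div_comm, div_le_div_iff₀ hkpos (by positivity)]
      linarith
    rw [h1, Real.norm_of_nonneg (by positivity), Real.norm_of_nonneg (by positivity), mul_assoc,
      ← one_div_pow, ← mul_pow]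
    gcongr
  have hae := ae_tendsto_zero_of_lintegral_le (P := P)
    (X := fun n ω => ENNReal.ofReal (((∑ i ∈ S n, (f (Y n ω i) - m)) / k n) ^ 4))
    (fun n => (((hmeas n).pow_const 4).ennreal_ofReal.comp_aemeasurable (hYm n))) hsum
    (fun n => by positivity) (fun n => by
      obtain ⟨hi, hb⟩ := hC n (S n)
      have hi' : Integrable (fun y : Fin n → α => ((∑ i ∈ S n, (f (y i) - m)) / k n) ^ 4)
          (Measure.pi fun _ => μ) := by
        simp only [div_pow]
        exact hi.div_const _
      have e := lintegral_map' (μ := P)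
        ((hmeas n).pow_const 4).ennreal_ofReal.aemeasurable (hYm n)
      refine e.symm.trans_le ?_
      rw [hY n]
      refine (ofReal_integral_eq_lintegral_ofReal hi'
        (ae_of_all _ fun y => by positivity)).symm.trans_le (ENNReal.ofReal_le_ofReal ?_)
      simp only [div_pow]
      rw [integral_div]
      rw [hS] at hb
      gcongr)
  have hkpos : ∀ᶠ n in atTop, 0 < (k n : ℝ) / n := hk.eventually_const_lt hκ
  filter_upwards [hae] with ω hω
  have h4 : Tendsto (fun n => ((∑ i ∈ S n, (f (Y n ω i) - m)) / k n) ^ 4) atTop (𝓝 0) := by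
    have := (ENNReal.tendsto_toReal ENNReal.zero_ne_top).comp hω
    refine this.congr fun n => ?_
    simp only [Function.comp]
    rw [ENNReal.toReal_ofReal (by positivity)]
  have h1 := tendsto_zero_of_pow_four h4
  have h2 := h1.add_const m
  rw [zero_add] at h2
  refine h2.congr' ?_
  filter_upwards [hkpos] with n hn
  have hk0 : (k n : ℝ) ≠ 0 := fun h => by simp [h] at hn
  rw [Finset.sum_sub_distrib, Finset.sum_const, hS, nsmul_eq_mul]
  field_simp
  ring

/-- The averaged power `(1/J) ∑_j u_j²`. -/
def avgPower {J : ℕ} (u : Fin J → ℝ) : ℝ := (∑ j, u j ^ 2) / J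

lemma avgPower_nonneg {J : ℕ} (u : Fin J → ℝ) : 0 ≤ avgPower u := by
  unfold avgPower; positivity

lemma measurable_avgPower {J : ℕ} : Measurable (avgPower (J := J)) := by
  unfold avgPower; fun_prop

lemma restrictedPower_eq {n J : ℕ} (k : ℕ) (Δ : Finset (Fin n)) (x : Fin J → Fin n → ℝ) :
    (1 / ((k : ℝ) * J)) * ∑ j : Fin J, ∑ i ∈ Δ, (x j i) ^ 2 =
      (∑ i ∈ Δ, avgPower fun j => x j i) / k := by
  simp only [avgPower]
  rw [Finset.sum_comm, ← Finset.sum_div, div_div, one_div_mul_eq_div, mul_comm]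

lemma minRestrictedPower_le {n J k a : ℕ} {S T : Finset (Fin n)} (x : Fin J → Fin n → ℝ)
    (hT : T ⊆ S) (ha : a ≤ T.card) :
    minRestrictedPower n J k a S x ≤ (∑ i ∈ T, avgPower fun j => x j i) / k := by
  obtain ⟨Δ, hΔT, hΔ⟩ := Finset.exists_subset_card_eq ha
  unfold minRestrictedPower
  refine le_trans
    (csInf_le ⟨0, ?_⟩ ⟨Δ, Finset.mem_powersetCard.2 ⟨hΔT.trans hT, hΔ⟩, rfl⟩) ?_
  · rintro v ⟨Δ, -, rfl⟩
    positivity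
  · rw [restrictedPower_eq]
    gcongr
    exact fun i _ _ => avgPower_nonneg _

lemma sum_filter_le_of_card_le {ι : Type*} {S Δ : Finset ι} (y : ι → ℝ) {t : ℝ} (ht : 0 ≤ t)
    (hΔ : Δ ⊆ S) (h : (S.filter fun i => y i ≤ t).card ≤ Δ.card) :
    ∑ i ∈ S with y i ≤ t, y i ≤ ∑ i ∈ Δ, y i := by
  classical
  set A := S.filter fun i => y i ≤ t with hA
  have h1 : ∑ i ∈ A \ Δ, y i ≤ (A \ Δ).card * t := by
    rw [← nsmul_eq_mul]
    exact Finset.sum_le_card_nsmul _ _ _ fun i hi =>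
      (Finset.mem_filter.1 (Finset.mem_sdiff.1 hi).1).2
  have h2 : (Δ \ A).card * t ≤ ∑ i ∈ Δ \ A, y i := by
    rw [← nsmul_eq_mul]
    refine Finset.card_nsmul_le_sum _ _ _ fun i hi => ?_
    obtain ⟨hi, hiA⟩ := Finset.mem_sdiff.1 hi
    by_contra! hlt
    exact hiA (Finset.mem_filter.2 ⟨hΔ hi, hlt.le⟩)
  have h3 : ((A \ Δ).card : ℝ) ≤ (Δ \ A).card := by
    exact_mod_cast Finset.card_sdiff_le_card_sdiff_iff.2 h
  rw [← Finset.sum_inter_add_sum_sdiff A Δ, ← Finset.sum_inter_add_sum_sdiff Δ A,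
    Finset.inter_comm Δ A]
  nlinarith

lemma le_minRestrictedPower {n J k a : ℕ} {S : Finset (Fin n)} (x : Fin J → Fin n → ℝ) {t : ℝ}
    (ht : 0 ≤ t) (haS : a ≤ S.card)
    (ha : (S.filter fun i => avgPower (fun j => x j i) ≤ t).card ≤ a) :
    (∑ i ∈ S with avgPower (fun j => x j i) ≤ t, avgPower fun j => x j i) / k ≤
      minRestrictedPower n J k a S x := by
  refine le_csInf ?_ ?_
  · obtain ⟨Δ, hΔ⟩ := Finset.powersetCard_nonempty.2 haS
    exact ⟨_, Δ, hΔ, rfl⟩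
  · rintro v ⟨Δ, hΔ, rfl⟩
    obtain ⟨hΔS, rfl⟩ := Finset.mem_powersetCard.1 hΔ
    rw [restrictedPower_eq]
    exact div_le_div_of_nonneg_right (sum_filter_le_of_card_le _ ht hΔS ha) (Nat.cast_nonneg k)

/-- The law of the normalized chi-square with `J` degrees of freedom. -/
def chiLaw (J : ℕ) : Measure ℝ := (gaussianPi (Fin J)).map avgPower

instance (J : ℕ) : IsProbabilityMeasure (chiLaw J) :=
  Measure.isProbabilityMeasure_map measurable_avgPower.aemeasurable

lemma chiCDF_eq_cdf {J : ℕ} (hJ : 1 ≤ J) (t : ℝ) : chiCDF J t = cdf (chiLaw J) t := by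
  have hJ0 : (0 : ℝ) < J := by exact_mod_cast hJ
  rw [cdf_eq_real, Measure.real, chiLaw, Measure.map_apply measurable_avgPower measurableSet_Iic]
  unfold chiCDF
  congr 2
  ext u
  simp [avgPower, div_le_iff₀ hJ0, mul_comm]

instance : NullSingletonClass stdGaussian := by
  unfold stdGaussian
  exact nullSingletonClass_gaussianReal one_ne_zero

lemma nullSingletonClass_chiLaw {J : ℕ} (hJ : 1 ≤ J) : NullSingletonClass (chiLaw J) := by
  obtain ⟨d, rfl⟩ : ∃ d, J = d + 1 := ⟨J - 1, by omega⟩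
  refine ⟨fun c => ?_⟩
  rw [chiLaw, Measure.map_apply measurable_avgPower (measurableSet_singleton c)]
  have mp := (measurePreserving_piFinSuccAbove (fun _ : Fin (d + 1) => stdGaussian) 0).symm
  have hm : MeasurableSet (avgPower (J := d + 1) ⁻¹' {c}) :=
    measurable_avgPower (measurableSet_singleton c)
  rw [gaussianPi, ← mp.measure_preimage hm.nullMeasurableSet,
    Measure.prod_apply_symm (mp.measurable hm), lintegral_eq_zero_of_ae_eq_zero]
  refine ae_of_all _ fun r => ?_
  set e : ℝ := (d + 1 : ℕ) * c - ∑ j, r j ^ 2 with he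
  refine measure_mono_null (t := {√e, -√e}) (fun x hx => ?_) ((Set.toFinite _).measure_zero _)
  have hd : (0 : ℝ) < (d + 1 : ℕ) := by positivity
  have hx' : x ^ 2 = e := by
    have hx1 : (∑ j, (Fin.cons x r : Fin (d + 1) → ℝ) j ^ 2) / (d + 1 : ℕ) = c := by
      simpa [avgPower] using hx
    rw [div_eq_iff hd.ne', Fin.sum_univ_succ] at hx1
    simp only [Fin.cons_zero, Fin.cons_succ] at hx1
    linarith
  rw [← hx', Real.sqrt_sq_eq_abs]
  rcases abs_choice x with h | h <;> simp [h]

lemma memLp_avgPower (J : ℕ) : MemLp (avgPower (J := J)) 4 (gaussianPi (Fin J)) := by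
  have h (j : Fin J) : MemLp (fun u : Fin J → ℝ => u j ^ 2) 4 (gaussianPi (Fin J)) := by
    have h8 : MemLp (fun x : ℝ => x) 8 stdGaussian := memLp_id_gaussianReal 8
    have h4 : MemLp (fun x : ℝ => x ^ 2) 4 stdGaussian := by
      have h := h8.norm_rpow_div 2
      have h84 : (8 : ℝ≥0∞) / 2 = 4 := by
        rw [show (8 : ℝ≥0∞) = 4 * 2 by norm_num]
        exact ENNReal.mul_div_cancel_right two_ne_zero ENNReal.ofNat_ne_top
      simpa [h84] using h
    exact h4.comp_measurePreserving (measurePreserving_eval (fun _ : Fin J => stdGaussian) j)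
  unfold avgPower
  simp only [div_eq_mul_inv]
  exact (memLp_finsetSum _ fun j _ => h j).mul_const _

lemma memLp_id_chiLaw (J : ℕ) : MemLp (fun y : ℝ => y) 4 (chiLaw J) :=
  (memLp_map_measure_iff (by fun_prop) measurable_avgPower.aemeasurable).2 (memLp_avgPower J)

lemma cdf_chiLaw_of_neg (J : ℕ) {t : ℝ} (ht : t < 0) : cdf (chiLaw J) t = 0 := by
  rw [cdf_eq_real, Measure.real, chiLaw, Measure.map_apply measurable_avgPower measurableSet_Iic]
  have : avgPower (J := J) ⁻¹' Set.Iic t = ∅ := by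
    ext u
    simpa using ht.trans_le (avgPower_nonneg u)
  simp [this]

lemma xi_nonneg (J : ℕ) (p : ℝ) : 0 ≤ xi J p := Real.sInf_nonneg fun _ ht => ht.1

/-- The quantile function is a left adjoint of the distribution function. -/
lemma xi_le_iff {J : ℕ} (hJ : 1 ≤ J) {p : ℝ} (hp : p ∈ Set.Ioo (0 : ℝ) 1) (t : ℝ) :
    xi J p ≤ t ↔ p ≤ cdf (chiLaw J) t := by
  unfold xi
  simp only [chiCDF_eq_cdf hJ]
  set A := {t : ℝ | 0 ≤ t ∧ p ≤ cdf (chiLaw J) t} with hA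
  have hbdd : BddBelow A := ⟨0, fun t ht => ht.1⟩
  have hne : A.Nonempty := by
    obtain ⟨t, ht, ht0⟩ := (((tendsto_cdf_atTop (chiLaw J)).eventually_const_lt hp.2).and
      (eventually_ge_atTop 0)).exists
    exact ⟨t, ht0, ht.le⟩
  constructor
  · intro h
    refine le_trans ?_ (monotone_cdf _ h)
    have hc : Tendsto (cdf (chiLaw J)) (𝓝[>] (sInf A)) (𝓝 (cdf (chiLaw J) (sInf A))) :=
      ((cdf (chiLaw J)).right_continuous _).mono Set.Ioi_subset_Ici_self
    refine ge_of_tendsto hc ?_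
    filter_upwards [self_mem_nhdsWithin] with s hs
    obtain ⟨r, hr, hrs⟩ := (csInf_lt_iff hbdd hne).1 hs
    exact hr.2.trans (monotone_cdf _ hrs.le)
  · intro h
    refine csInf_le hbdd ⟨?_, h⟩
    by_contra! ht
    rw [cdf_chiLaw_of_neg J ht] at h
    exact h.not_gt hp.1

lemma monotoneOn_xi {J : ℕ} (hJ : 1 ≤ J) : MonotoneOn (xi J) (Set.Ioo 0 1) := by
  intro p hp q hq hpq
  rw [xi_le_iff hJ hp]
  exact hpq.trans ((xi_le_iff hJ hq _).1 le_rfl)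

lemma cdf_xi {J : ℕ} (hJ : 1 ≤ J) {p : ℝ} (hp : p ∈ Set.Ioo (0 : ℝ) 1) :
    cdf (chiLaw J) (xi J p) = p := by
  refine le_antisymm ?_ ((xi_le_iff hJ hp _).1 le_rfl)
  have := nullSingletonClass_chiLaw hJ
  have h0 : (cdf (chiLaw J)).measure {xi J p} = 0 := by
    rw [measure_cdf]; exact measure_singleton _
  rw [StieltjesFunction.measure_singleton, ENNReal.ofReal_eq_zero, sub_nonpos] at h0
  refine h0.trans (le_of_tendsto ((monotone_cdf _).tendsto_leftLim _) ?_)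
  filter_upwards [self_mem_nhdsWithin] with s hs
  by_contra! h
  exact ((xi_le_iff hJ hp s).2 h.le).not_gt hs

lemma aemeasurable_xi {J : ℕ} (hJ : 1 ≤ J) :
    AEMeasurable (xi J) (volume.restrict (Set.Ioo 0 1)) :=
  aemeasurable_restrict_of_monotoneOn measurableSet_Ioo (monotoneOn_xi hJ)

instance : IsProbabilityMeasure (volume.restrict (Set.Ioo (0 : ℝ) 1)) := ⟨by simp⟩

/-- The quantile function transports the uniform law to the chi-square law. -/
lemma map_xi {J : ℕ} (hJ : 1 ≤ J) :
    (volume.restrict (Set.Ioo (0 : ℝ) 1)).map (xi J) = chiLaw J := by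
  have := Measure.isProbabilityMeasure_map (aemeasurable_xi hJ)
  refine Measure.ext_of_Iic _ _ fun t => ?_
  rw [Measure.map_apply_of_aemeasurable (aemeasurable_xi hJ) measurableSet_Iic, ← ofReal_cdf,
    Measure.restrict_apply' measurableSet_Ioo]
  have h1 : xi J ⁻¹' Set.Iic t ∩ Set.Ioo 0 1 = Set.Iic (cdf (chiLaw J) t) ∩ Set.Ioo 0 1 := by
    ext p
    simp only [Set.mem_inter_iff, Set.mem_preimage, Set.mem_Iic, and_congr_left_iff]
    exact fun hp => xi_le_iff hJ hp t
  rw [h1, measure_congr ((Filter.EventuallyEq.refl _ _).inter Ioo_ae_eq_Ioc),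
    Set.inter_comm, ← Set.Ioi_inter_Iic, Set.inter_assoc, Set.Iic_inter_Iic,
    min_eq_right (cdf_le_one _ _), Set.Ioi_inter_Iic, Real.volume_Ioc, sub_zero]

lemma intervalIntegrable_xi {J : ℕ} (hJ : 1 ≤ J) : IntervalIntegrable (xi J) volume 0 1 := by
  rw [intervalIntegrable_iff_integrableOn_Ioo_of_le zero_le_one]
  have h : Integrable (fun y : ℝ => y) ((volume.restrict (Set.Ioo (0 : ℝ) 1)).map (xi J)) := by
    rw [map_xi hJ]
    exact (memLp_id_chiLaw J).integrable (by norm_num)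
  exact h.comp_aemeasurable (aemeasurable_xi hJ)

lemma continuousOn_Ppow {J : ℕ} (hJ : 1 ≤ J) : ContinuousOn (Ppow J) (Set.Icc 0 1) := by
  have := intervalIntegral.continuousOn_primitive_interval' (intervalIntegrable_xi hJ)
    Set.left_mem_uIcc
  rwa [Set.uIcc_of_le zero_le_one] at this

lemma integral_chiLaw {J : ℕ} (hJ : 1 ≤ J) : ∫ y, y ∂(chiLaw J) = Ppow J 1 := by
  rw [← map_xi hJ, integral_map (aemeasurable_xi hJ) (by fun_prop), Ppow,
    intervalIntegral.integral_of_le zero_le_one, integral_Ioc_eq_integral_Ioo]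

lemma integral_indicator_chiLaw {J : ℕ} (hJ : 1 ≤ J) {q : ℝ} (hq : q ∈ Set.Ioo (0 : ℝ) 1) :
    ∫ y, (Set.Iic (xi J q)).indicator (fun y => y) y ∂(chiLaw J) = Ppow J q := by
  rw [← map_xi hJ, integral_map (aemeasurable_xi hJ)
    (measurable_id'.indicator measurableSet_Iic).aestronglyMeasurable, Ppow,
    intervalIntegral.integral_of_le hq.1.le]
  have h1 : ∀ p ∈ Set.Ioo (0 : ℝ) 1, (Set.Iic (xi J q)).indicator (fun y => y) (xi J p) =
      (Set.Iic q).indicator (xi J) p := by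
    intro p hp
    simp only [Set.indicator_apply, Set.mem_Iic, xi_le_iff hJ hp, cdf_xi hJ hq]
  rw [setIntegral_congr_fun measurableSet_Ioo h1, setIntegral_indicator measurableSet_Iic]
  congr 2
  ext p
  simp only [Set.mem_inter_iff, Set.mem_Ioo, Set.mem_Iic, Set.mem_Ioc]
  exact ⟨fun h => ⟨h.1.1, h.2⟩, fun h => ⟨⟨h.1, h.2.trans_lt hq.2⟩, h.2⟩⟩

/-- Transposition preserves i.i.d. product measures. -/
lemma map_transpose_pi {ι κ X : Type*} [Fintype ι] [Fintype κ] [MeasurableSpace X]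
    (μ : Measure X) [IsProbabilityMeasure μ] :
    (Measure.pi fun _ : ι => Measure.pi fun _ : κ => μ).map (fun x i j => x j i) =
      Measure.pi fun _ : κ => Measure.pi fun _ : ι => μ := by
  simp only [← Measure.infinitePi_eq_pi]
  rw [← Measure.infinitePi_map_curry (fun (_ : ι) (_ : κ) => μ),
    ← Measure.infinitePi_map_curry (fun (_ : κ) (_ : ι) => μ),
    ← Measure.map_infinitePi_infinitePi_of_inj (P := fun _ : ι × κ => μ)
      (f := (Prod.swap : κ × ι → ι × κ)) Prod.swap_injective,
    Measure.map_map (by fun_prop) (by fun_prop), Measure.map_map (by fun_prop) (by fun_prop)]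
  rfl

lemma ae_tendsto_average_avgPower {Ω : Type*} [MeasurableSpace Ω] (P : Measure Ω)
    [IsProbabilityMeasure P] {J : ℕ} {κ : ℝ} (hκ : 0 < κ) {k : ℕ → ℕ}
    (hk : Tendsto (fun n => (k n : ℝ) / n) atTop (𝓝 κ))
    {S : ∀ n, Finset (Fin n)} (hS : ∀ n, (S n).card = k n) {Rv : ∀ n, Ω → Fin J → Fin n → ℝ}
    (hRv : ∀ n, Measure.map (Rv n) P = Measure.pi fun _ : Fin J => gaussianPi (Fin n))
    {f : ℝ → ℝ} (hfm : Measurable f) (hf : MemLp f 4 (chiLaw J)) :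
    ∀ᵐ ω ∂P, Tendsto (fun n => (∑ i ∈ S n, f (avgPower fun j => Rv n ω j i)) / k n) atTop
      (𝓝 (∫ y, f y ∂(chiLaw J))) := by
  have hRm (n : ℕ) : AEMeasurable (Rv n) P :=
    aemeasurable_of_map_neZero (by rw [hRv]; infer_instance)
  have ht (n : ℕ) : Measurable fun (x : Fin J → Fin n → ℝ) i j => x j i := by fun_prop
  have h := ae_tendsto_average (gaussianPi (Fin J)) P hκ hk hS
    (Y := fun n ω i j => Rv n ω j i) (fun n => (ht n).comp_aemeasurable (hRm n))
    (fun n => by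
      have e := AEMeasurable.map_map_of_aemeasurable (ht n).aemeasurable (hRm n)
      rw [hRv] at e
      exact e.symm.trans (map_transpose_pi stdGaussian))
    (hfm.comp measurable_avgPower)
    ((memLp_map_measure_iff hfm.aestronglyMeasurable measurable_avgPower.aemeasurable).1 hf)
  rw [chiLaw, integral_map measurable_avgPower.aemeasurable hfm.aestronglyMeasurable]
  exact h

lemma ae_tendsto_count_and_truncated_power {Ω : Type*} [MeasurableSpace Ω] (P : Measure Ω)
    [IsProbabilityMeasure P] {J : ℕ} (hJ : 1 ≤ J) {κ : ℝ} (hκ : 0 < κ) {k : ℕ → ℕ}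
    (hk : Tendsto (fun n => (k n : ℝ) / n) atTop (𝓝 κ))
    {S : ∀ n, Finset (Fin n)} (hS : ∀ n, (S n).card = k n) {Rv : ∀ n, Ω → Fin J → Fin n → ℝ}
    (hRv : ∀ n, Measure.map (Rv n) P = Measure.pi fun _ : Fin J => gaussianPi (Fin n))
    {q : ℝ} (hq : q ∈ Set.Ioo (0 : ℝ) 1) :
    ∀ᵐ ω ∂P,
      Tendsto (fun n =>
        (((S n).filter fun i => avgPower (fun j => Rv n ω j i) ≤ xi J q).card : ℝ) / k n)
        atTop (𝓝 q) ∧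
      Tendsto (fun n => (∑ i ∈ S n with avgPower (fun j => Rv n ω j i) ≤ xi J q,
        avgPower fun j => Rv n ω j i) / k n) atTop (𝓝 (Ppow J q)) := by
  have h1 := ae_tendsto_average_avgPower P hκ hk hS hRv
    (f := (Set.Iic (xi J q)).indicator fun _ => 1) (measurable_const.indicator measurableSet_Iic)
    ((memLp_const 1).indicator measurableSet_Iic)
  have h2 := ae_tendsto_average_avgPower P hκ hk hS hRv
    (f := (Set.Iic (xi J q)).indicator fun y => y) (measurable_id'.indicator measurableSet_Iic)
    ((memLp_id_chiLaw J).indicator measurableSet_Iic)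
  rw [integral_indicator_chiLaw hJ hq] at h2
  rw [integral_indicator_const _ measurableSet_Iic, smul_eq_mul, mul_one, ← cdf_eq_real,
    cdf_xi hJ hq] at h1
  filter_upwards [h1, h2] with ω hω1 hω2
  simp only [Set.indicator_apply, Set.mem_Iic, ← Finset.sum_filter] at hω1 hω2
  refine ⟨?_, hω2⟩
  simpa using hω1

/-- **Convergence of the diversity power.** If the nonzero values are i.i.d. standard
gaussian then `P_J^{(n)}(β)` converges almost surely to `P_J(β) = ∫_0^β ξ_J(p) dp`. -/
theorem diversity_power_convergence
    (J : ℕ) (hJ : 1 ≤ J) (β κ : ℝ) (hβ : β ∈ Set.Ioc 0 1) (hκ : κ ∈ Set.Ioo 0 (1/2))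
    (k : ℕ → ℕ) (hk : Tendsto (fun n => (k n : ℝ) / n) atTop (𝓝 κ))
    (S : ∀ n, Finset (Fin n)) (hS : ∀ n, (S n).card = k n)
    (Ω : Type) [MeasurableSpace Ω] (P : Measure Ω) [IsProbabilityMeasure P]
    (Rv : ∀ n, Ω → Fin J → Fin n → ℝ)
    (hRv : ∀ n, Measure.map (Rv n) P = Measure.pi fun _ : Fin J => gaussianPi (Fin n)) :
    ∀ᵐ ω ∂P,
      Tendsto (fun n => minRestrictedPower n J (k n) ⌊β * k n⌋₊ (S n) (Rv n ω))
        atTop (𝓝 (Ppow J β)) := by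
  have hcont := continuousOn_Ppow hJ
  have hβm : β ∈ Set.Icc (0 : ℝ) 1 := ⟨hβ.1.le, hβ.2⟩
  have hrat : ∀ᵐ ω ∂P, ∀ q : ℚ, (q : ℝ) ∈ Set.Ioo (0 : ℝ) 1 →
      Tendsto (fun n =>
        (((S n).filter fun i => avgPower (fun j => Rv n ω j i) ≤ xi J q).card : ℝ) / k n)
        atTop (𝓝 q) ∧
      Tendsto (fun n => (∑ i ∈ S n with avgPower (fun j => Rv n ω j i) ≤ xi J q,
        avgPower fun j => Rv n ω j i) / k n) atTop (𝓝 (Ppow J q)) := by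
    rw [ae_all_iff]
    intro q
    by_cases hq : (q : ℝ) ∈ Set.Ioo (0 : ℝ) 1
    · filter_upwards [ae_tendsto_count_and_truncated_power P hJ hκ.1 hk hS hRv hq] with ω hω _
      exact hω
    · exact ae_of_all _ fun ω h => absurd h hq
  have htot := ae_tendsto_average_avgPower P hκ.1 hk hS hRv measurable_id' (memLp_id_chiLaw J)
  rw [integral_chiLaw hJ] at htot
  have hkn : ∀ᶠ n in atTop, 0 < (k n : ℝ) := by
    filter_upwards [hk.eventually_const_lt hκ.1] with n hn
    by_contra! h
    rw [le_antisymm h (Nat.cast_nonneg _), zero_div] at hn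
    exact lt_irrefl _ hn
  have hktop : Tendsto (fun n => (k n : ℝ)) atTop atTop := by
    have h := hk.pos_mul_atTop hκ.1 (tendsto_natCast_atTop_atTop (R := ℝ))
    refine h.congr' ?_
    filter_upwards [eventually_gt_atTop 0] with n hn
    exact div_mul_cancel₀ _ (by positivity)
  have hfloor : Tendsto (fun n => (⌊β * k n⌋₊ : ℝ) / k n) atTop (𝓝 β) :=
    (tendsto_nat_floor_mul_div_atTop hβ.1.le).comp hktop
  have hle (n : ℕ) : ⌊β * k n⌋₊ ≤ (S n).card := by
    rw [hS]
    exact Nat.floor_le_of_le (mul_le_of_le_one_left (Nat.cast_nonneg _) hβ.2)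
  filter_upwards [hrat, htot] with ω hω hωtot
  refine tendsto_order.2 ⟨fun L hL => ?_, fun U hU => ?_⟩
  · have hnear : ∀ᶠ q in 𝓝[<] β, L < Ppow J q ∧ q ∈ Set.Ioo 0 β := by
      have h1 : Tendsto (Ppow J) (𝓝[<] β) (𝓝 (Ppow J β)) :=
        (hcont β hβm).mono_left (nhdsWithin_le_of_mem (mem_of_superset
          (Ioo_mem_nhdsLT hβ.1) fun q hq => ⟨hq.1.le, hq.2.le.trans hβ.2⟩))
      exact (h1.eventually_const_lt hL).and (Ioo_mem_nhdsLT hβ.1)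
    obtain ⟨l, hl, hlβ⟩ := (mem_nhdsLT_iff_exists_Ioo_subset' hβ.1).1 hnear
    obtain ⟨q, hlq, hqβ⟩ := exists_rat_btwn (Set.mem_Iio.1 hl)
    obtain ⟨hLq, hq0, -⟩ := hlβ ⟨hlq, hqβ⟩
    obtain ⟨hcount, hpow⟩ := hω q ⟨hq0, hqβ.trans_le hβ.2⟩
    filter_upwards [hcount.eventually_lt hfloor hqβ, hpow.eventually_const_lt hLq, hkn]
      with n h1 h2 h3
    refine h2.trans_le (le_minRestrictedPower _ (xi_nonneg J q) (hle n) ?_)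
    rw [div_lt_div_iff_of_pos_right h3] at h1
    exact_mod_cast h1.le
  · rcases hβ.2.eq_or_lt with rfl | hβ1
    · filter_upwards [hωtot.eventually_lt_const hU] with n h
      exact (minRestrictedPower_le _ (Finset.Subset.refl _) (hle n)).trans_lt h
    · have hnear : ∀ᶠ q in 𝓝[>] β, Ppow J q < U ∧ q ∈ Set.Ioo β 1 := by
        have h1 : Tendsto (Ppow J) (𝓝[>] β) (𝓝 (Ppow J β)) :=
          (hcont β hβm).mono_left (nhdsWithin_le_of_mem (mem_of_superset
            (Ioo_mem_nhdsGT hβ1) fun q hq => ⟨hβ.1.le.trans hq.1.le, hq.2.le⟩))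
        exact (h1.eventually_lt_const hU).and (Ioo_mem_nhdsGT hβ1)
      obtain ⟨u, hu, hβu⟩ := (mem_nhdsGT_iff_exists_Ioo_subset' hβ1).1 hnear
      obtain ⟨q, hβq, hqu⟩ := exists_rat_btwn (Set.mem_Ioi.1 hu)
      obtain ⟨hqU, -, hq1⟩ := hβu ⟨hβq, hqu⟩
      obtain ⟨hcount, hpow⟩ := hω q ⟨hβ.1.trans hβq, hq1⟩
      filter_upwards [hfloor.eventually_lt hcount hβq, hpow.eventually_lt_const hqU, hkn]
        with n h1 h2 h3
      refine (minRestrictedPower_le _ (Finset.filter_subset _ _) ?_).trans_lt h2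
      rw [div_lt_div_iff_of_pos_right h3] at h1
      exact_mod_cast h1.le

end Sparsity
end
end
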